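/- arXiv:2605.07950 — 5 statements merged into one kernel-verified Lean document; each statement's English description precedes it below -/
import Mathlib

section
/- Let V : ℝ^d → ℝ be continuously differentiable with ⟨x, ∇V(x)⟩ ≥ c‖x‖² - C for all x (where c > 0, C ≥ 0) and ‖∇V(x)‖ ≤ G + L‖x‖ for all x. Let θ ∈ (0, c/2). Then ∫ e^{-V} dx < ∞, both integrals below are finite, and ∫ ⟨x, ∇V(x)⟩ e^{θ‖x‖²} e^{-V(x)} dx = ∫ (d + 2θ‖x‖²) e^{θ‖x‖²} e^{-V(x)} dx. -/
open MeasureTheory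
open scoped InnerProductSpace

/-- If the radial derivative of `f` is nonnegative outside a ball, then a continuously
differentiable `f` is bounded below. -/
lemma exists_lower_bound_of_radial_fderiv_nonneg {d : ℕ} {f : EuclideanSpace ℝ (Fin d) → ℝ}
    (hf : ContDiff ℝ 1 f) {R : ℝ} (hR : 0 < R)
    (h : ∀ x, R ≤ ‖x‖ → 0 ≤ fderiv ℝ f x x) : ∃ K : ℝ, ∀ x, -K ≤ f x := by
  obtain ⟨m, hm⟩ := (isCompact_closedBall (0 : EuclideanSpace ℝ (Fin d)) R).bddBelow_image
    hf.continuous.continuousOn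
  have hm' : ∀ x, ‖x‖ ≤ R → m ≤ f x := fun x hx =>
    hm ⟨x, by simpa using hx, rfl⟩
  refine ⟨-m, fun x => ?_⟩
  rw [neg_neg]
  rcases le_total ‖x‖ R with hx | hx
  · exact hm' x hx
  have hx0 : 0 < ‖x‖ := hR.trans_le hx
  have hder : ∀ t : ℝ, HasDerivAt (fun t : ℝ => f (t • x)) (fderiv ℝ f (t • x) x) t := fun t => by
    have h1 : HasDerivAt (fun t : ℝ => t • x) x t := by
      simpa using (hasDerivAt_id t).smul_const x
    exact ((hf.differentiable one_ne_zero) (t • x)).hasFDerivAt.comp_hasDerivAt t h1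
  have hmono : MonotoneOn (fun t : ℝ => f (t • x)) (Set.Icc (R / ‖x‖) 1) := by
    refine monotoneOn_of_deriv_nonneg (convex_Icc _ _)
      (fun t _ => (hder t).continuousAt.continuousWithinAt)
      (fun t _ => (hder t).differentiableAt.differentiableWithinAt) fun t ht => ?_
    rw [interior_Icc] at ht
    have ht0 : 0 < t := (div_pos hR hx0).trans ht.1
    rw [(hder t).deriv]
    have h2 := h (t • x) (by
      rw [norm_smul, Real.norm_of_nonneg ht0.le]
      exact ((div_lt_iff₀ hx0).1 ht.1).le)
    rw [map_smul, smul_eq_mul] at h2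
    exact nonneg_of_mul_nonneg_right h2 ht0
  have hle : R / ‖x‖ ≤ 1 := (div_le_one hx0).2 hx
  have h3 := hmono ⟨le_rfl, hle⟩ ⟨hle, le_rfl⟩ hle
  simp only [one_smul] at h3
  refine (hm' _ ?_).trans h3
  rw [norm_smul, Real.norm_of_nonneg (div_pos hR hx0).le, div_mul_cancel₀ _ hx0.ne']

lemma fderiv_apply_eq_inner_gradient {d : ℕ} (V : EuclideanSpace ℝ (Fin d) → ℝ)
    (x v : EuclideanSpace ℝ (Fin d)) :
    fderiv ℝ V x v = ⟪v, gradient V x⟫_ℝ := by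
  rw [real_inner_comm]
  simp [gradient]

/-- A radially dissipative potential grows at least quadratically, at any rate `a < c / 2`. -/
lemma exists_quadratic_lower_bound_of_dissipative {d : ℕ} {V : EuclideanSpace ℝ (Fin d) → ℝ}
    (hV : ContDiff ℝ 1 V) {a c C : ℝ} (hC : 0 ≤ C) (ha : a < c / 2)
    (hdiss : ∀ x, c * ‖x‖ ^ 2 - C ≤ fderiv ℝ V x x) :
    ∃ K : ℝ, ∀ x, a * ‖x‖ ^ 2 - K ≤ V x := by
  have hpos : 0 < c - 2 * a := by linarith
  have hsq : ContDiff ℝ 1 fun x : EuclideanSpace ℝ (Fin d) => a * ‖x‖ ^ 2 :=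
    contDiff_const.mul (contDiff_norm_sq ℝ)
  obtain ⟨K, hK⟩ := exists_lower_bound_of_radial_fderiv_nonneg (hV.sub hsq)
    (R := C / (c - 2 * a) + 1) (by positivity) (fun x hx => by
      have h1 : HasFDerivAt (fun x => V x - a * ‖x‖ ^ 2) _ x :=
        ((hV.differentiable one_ne_zero) x).hasFDerivAt.sub
          ((hasStrictFDerivAt_norm_sq x).hasFDerivAt.const_mul a)
      rw [h1.fderiv]
      simp only [sub_apply, smul_apply, smul_eq_mul,
        innerSL_apply_apply, real_inner_self_eq_norm_sq, nsmul_eq_mul, Nat.cast_ofNat]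
      have h2 := hdiss x
      have h0 : 0 ≤ C / (c - 2 * a) := by positivity
      have h3 : C / (c - 2 * a) ≤ ‖x‖ ^ 2 := by nlinarith
      rw [div_le_iff₀ hpos] at h3
      linarith)
  exact ⟨K, fun x => by linarith [hK x]⟩

lemma integrable_exp_neg_mul_norm_sq {d : ℕ} {b : ℝ} (hb : 0 < b) :
    Integrable fun x : EuclideanSpace ℝ (Fin d) => Real.exp (-b * ‖x‖ ^ 2) := by
  have h := (GaussianFourier.integrable_cexp_neg_mul_sq_norm_add (b := (b : ℂ))
    (by simpa using hb) 0 (0 : EuclideanSpace ℝ (Fin d))).norm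
  refine h.congr (Filter.Eventually.of_forall fun x => ?_)
  simp [Complex.norm_exp, ← Complex.ofReal_pow]

lemma integrable_mul_exp_of_quadratic_bound {d : ℕ} {V f : EuclideanSpace ℝ (Fin d) → ℝ}
    (hV : Continuous V) (hf : Continuous f) {a K A θ : ℝ} (hθ : θ < a)
    (hlow : ∀ x, a * ‖x‖ ^ 2 - K ≤ V x) (hbd : ∀ x, |f x| ≤ A * (1 + ‖x‖ ^ 2)) :
    Integrable fun x => f x * Real.exp (θ * ‖x‖ ^ 2 - V x) := by
  obtain ⟨b, hb⟩ : ∃ b, b = (a - θ) / 2 := ⟨_, rfl⟩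
  have hb0 : 0 < b := by linarith
  have hA : 0 ≤ A := by simpa using (abs_nonneg _).trans (hbd 0)
  refine ((integrable_exp_neg_mul_norm_sq hb0).const_mul
    (A * (1 + 1 / b) * Real.exp K)).mono' (by fun_prop) (Filter.Eventually.of_forall fun x => ?_)
  rw [norm_mul, Real.norm_eq_abs, Real.norm_of_nonneg (Real.exp_pos _).le]
  have h1 : 1 + ‖x‖ ^ 2 ≤ (1 + 1 / b) * Real.exp (b * ‖x‖ ^ 2) := by
    have h2 := Real.add_one_le_exp (b * ‖x‖ ^ 2)
    have h3 : 0 ≤ ‖x‖ ^ 2 := by positivity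
    have h4 : 0 ≤ b * ‖x‖ ^ 2 := by positivity
    calc 1 + ‖x‖ ^ 2 ≤ (1 + 1 / b) * (b * ‖x‖ ^ 2 + 1) := by
          have : (1 + 1 / b) * (b * ‖x‖ ^ 2 + 1) = b * ‖x‖ ^ 2 + 1 + ‖x‖ ^ 2 + 1 / b := by
            field_simp
            ring
          have : 0 ≤ 1 / b := by positivity
          linarith
      _ ≤ _ := by gcongr
  have h5 : Real.exp (θ * ‖x‖ ^ 2 - V x) ≤
      Real.exp K * (Real.exp (-b * ‖x‖ ^ 2) * Real.exp (-b * ‖x‖ ^ 2)) := by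
    rw [← Real.exp_add, ← Real.exp_add, Real.exp_le_exp]
    have := hlow x
    rw [hb]
    linarith
  calc |f x| * Real.exp (θ * ‖x‖ ^ 2 - V x)
      ≤ A * ((1 + 1 / b) * Real.exp (b * ‖x‖ ^ 2)) *
        (Real.exp K * (Real.exp (-b * ‖x‖ ^ 2) * Real.exp (-b * ‖x‖ ^ 2))) := by
        gcongr
        exact (hbd x).trans (by gcongr)
    _ = A * (1 + 1 / b) * Real.exp K * Real.exp (-b * ‖x‖ ^ 2) *
        (Real.exp (b * ‖x‖ ^ 2) * Real.exp (-b * ‖x‖ ^ 2)) := by ring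
    _ = _ := by
        rw [← Real.exp_add, show b * ‖x‖ ^ 2 + -b * ‖x‖ ^ 2 = 0 by ring, Real.exp_zero, mul_one]

/-- The divergence theorem without boundary term for the vector field `x ↦ g x • x`. -/
lemma integral_fderiv_apply_self {d : ℕ} {g : EuclideanSpace ℝ (Fin d) → ℝ}
    (hg : Differentiable ℝ g) (hint : Integrable g)
    (hmul : ∀ i, Integrable fun x : EuclideanSpace ℝ (Fin d) => x i * g x)
    (hder : ∀ i, Integrable fun x : EuclideanSpace ℝ (Fin d) =>
      x i * fderiv ℝ g x (EuclideanSpace.single i 1)) :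
    ∫ x, fderiv ℝ g x x = -(d * ∫ x, g x) := by
  have key : ∀ i, ∫ x : EuclideanSpace ℝ (Fin d),
      x i * fderiv ℝ g x (EuclideanSpace.single i 1) = -∫ x, g x := fun i => by
    have h := integral_bilinear_hasFDerivAt_right_eq_neg_left_of_integrable
      (μ := (volume : Measure (EuclideanSpace ℝ (Fin d))))
      (f := fun x => x i) (f' := fun _ => EuclideanSpace.proj i) (g := g) (g' := fderiv ℝ g)
      (v := EuclideanSpace.single i 1) (B := ContinuousLinearMap.mul ℝ ℝ)
      (by simpa using hint) (by simpa using hder i) (by simpa using hmul i)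
      (fun x _ => (EuclideanSpace.proj i : EuclideanSpace ℝ (Fin d) →L[ℝ] ℝ).hasFDerivAt)
      (fun x _ => (hg x).hasFDerivAt)
    simpa using h
  have hsum : ∀ x : EuclideanSpace ℝ (Fin d),
      fderiv ℝ g x x = ∑ i, x i * fderiv ℝ g x (EuclideanSpace.single i 1) := fun x => by
    have h := congrArg (fderiv ℝ g x) ((EuclideanSpace.basisFun (Fin d) ℝ).sum_repr x)
    rw [map_sum] at h
    simpa using h.symm
  simp_rw [hsum]
  rw [integral_finsetSum _ fun i _ => hder i]
  simp [key]

theorem stmt_6 {d : ℕ} (V : EuclideanSpace ℝ (Fin d) → ℝ) (hV : ContDiff ℝ 1 V)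
    (c C G L : ℝ) (hc : 0 < c) (hC : 0 ≤ C)
    (hdiss : ∀ x : EuclideanSpace ℝ (Fin d), ⟪x, gradient V x⟫_ℝ ≥ c * ‖x‖ ^ 2 - C)
    (hgrow : ∀ x : EuclideanSpace ℝ (Fin d), ‖gradient V x‖ ≤ G + L * ‖x‖)
    (θ : ℝ) (hθ : θ ∈ Set.Ioo 0 (c / 2)) :
    Integrable (fun x : EuclideanSpace ℝ (Fin d) => Real.exp (-V x)) ∧
    Integrable (fun x : EuclideanSpace ℝ (Fin d) =>
      ⟪x, gradient V x⟫_ℝ * Real.exp (θ * ‖x‖ ^ 2) * Real.exp (-V x)) ∧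
    Integrable (fun x : EuclideanSpace ℝ (Fin d) =>
      ((d : ℝ) + 2 * θ * ‖x‖ ^ 2) * Real.exp (θ * ‖x‖ ^ 2) * Real.exp (-V x)) ∧
    ∫ x : EuclideanSpace ℝ (Fin d),
        ⟪x, gradient V x⟫_ℝ * Real.exp (θ * ‖x‖ ^ 2) * Real.exp (-V x) =
      ∫ x : EuclideanSpace ℝ (Fin d),
        ((d : ℝ) + 2 * θ * ‖x‖ ^ 2) * Real.exp (θ * ‖x‖ ^ 2) * Real.exp (-V x) := by
  obtain ⟨hθ0, hθc⟩ := hθ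
  obtain ⟨a, hθa, hac⟩ := exists_between hθc
  have hVc : Continuous V := hV.continuous
  have hVd : Differentiable ℝ V := hV.differentiable one_ne_zero
  have hV' : Continuous (fderiv ℝ V) := hV.continuous_fderiv one_ne_zero
  obtain ⟨K, hK⟩ := exists_quadratic_lower_bound_of_dissipative hV hC hac fun x => by
    rw [fderiv_apply_eq_inner_gradient V]
    exact hdiss x
  have hexp : ∀ x, ∀ r : ℝ, r * Real.exp (θ * ‖x‖ ^ 2) * Real.exp (-V x) =
      r * Real.exp (θ * ‖x‖ ^ 2 - V x) := fun x r => by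
    rw [mul_assoc, ← Real.exp_add, sub_eq_add_neg]
  simp_rw [hexp, ← fderiv_apply_eq_inner_gradient V]
  have hint : ∀ {f : EuclideanSpace ℝ (Fin d) → ℝ} (A : ℝ), Continuous f →
      (∀ x, |f x| ≤ A * (1 + ‖x‖ ^ 2)) →
      Integrable fun x => f x * Real.exp (θ * ‖x‖ ^ 2 - V x) := fun A hf hbd =>
    integrable_mul_exp_of_quadratic_bound hVc hf hθa hK hbd
  have hlin : ∀ x : EuclideanSpace ℝ (Fin d), ‖x‖ ≤ 1 + ‖x‖ ^ 2 := fun x => by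
    nlinarith [sq_nonneg (‖x‖ - 1)]
  have hbound : ∀ x : EuclideanSpace ℝ (Fin d),
      ‖x‖ * ‖gradient V x‖ ≤ (|G| + |L|) * (1 + ‖x‖ ^ 2) := fun x => by
    have h0 := norm_nonneg x
    calc ‖x‖ * ‖gradient V x‖ ≤ ‖x‖ * (|G| + |L| * ‖x‖) := by
          gcongr
          refine (hgrow x).trans ?_
          gcongr <;> exact le_abs_self _
      _ = |G| * ‖x‖ + |L| * ‖x‖ ^ 2 := by ring
      _ ≤ |G| * (1 + ‖x‖ ^ 2) + |L| * (1 + ‖x‖ ^ 2) := by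
          gcongr
          · exact hlin x
          · linarith
      _ = _ := by ring
  have hI1 : Integrable fun x => Real.exp (θ * ‖x‖ ^ 2 - V x) := by
    simpa using hint (f := fun _ => 1) 1 continuous_const fun x => by
      simp only [abs_one, one_mul]
      nlinarith [sq_nonneg ‖x‖]
  have hI2 : Integrable fun x => fderiv ℝ V x x * Real.exp (θ * ‖x‖ ^ 2 - V x) :=
    hint (|G| + |L|) (by fun_prop) fun x => by
      rw [fderiv_apply_eq_inner_gradient V]
      exact (abs_real_inner_le_norm _ _).trans (hbound x)
  have hI3 : Integrable fun x : EuclideanSpace ℝ (Fin d) =>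
      ((d : ℝ) + 2 * θ * ‖x‖ ^ 2) * Real.exp (θ * ‖x‖ ^ 2 - V x) :=
    hint (d + 2 * θ) (by fun_prop) fun x => by
      rw [abs_of_nonneg (by positivity)]
      have : 0 ≤ (d : ℝ) * ‖x‖ ^ 2 := by positivity
      linarith
  refine ⟨?_, hI2, hI3, ?_⟩
  · refine (hint (f := fun x => Real.exp (-θ * ‖x‖ ^ 2)) 1 (by fun_prop) fun x => ?_).congr
      (Filter.Eventually.of_forall fun x => ?_)
    · rw [abs_of_pos (Real.exp_pos _)]
      have h1 : 0 ≤ θ * ‖x‖ ^ 2 := by positivity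
      have h2 : Real.exp (-θ * ‖x‖ ^ 2) ≤ 1 := Real.exp_le_one_iff.2 (by linarith)
      nlinarith [sq_nonneg ‖x‖]
    · simp only [← Real.exp_add]
      congr 1
      ring
  have hg : ∀ x, HasFDerivAt (fun x => Real.exp (θ * ‖x‖ ^ 2 - V x)) _ x := fun x =>
    (((hasStrictFDerivAt_norm_sq x).hasFDerivAt.const_mul θ).sub (hVd x).hasFDerivAt).exp
  have hg' : ∀ x v, fderiv ℝ (fun x => Real.exp (θ * ‖x‖ ^ 2 - V x)) x v =
      (2 * θ * ⟪x, v⟫_ℝ - fderiv ℝ V x v) * Real.exp (θ * ‖x‖ ^ 2 - V x) := fun x v => by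
    rw [(hg x).fderiv]
    simp only [sub_apply, smul_apply, smul_eq_mul,
      innerSL_apply_apply, nsmul_eq_mul, Nat.cast_ofNat, Pi.sub_apply]
    ring
  have hcoord : ∀ (x : EuclideanSpace ℝ (Fin d)) i, |x i| ≤ ‖x‖ := fun x i =>
    PiLp.norm_apply_le x i
  have hdiv := integral_fderiv_apply_self (fun x => (hg x).differentiableAt) hI1
    (fun i => hint 1 (by fun_prop) fun x => by
      rw [one_mul]
      exact (hcoord x i).trans (hlin x))
    (fun i => by
      simp_rw [hg', ← mul_assoc]
      refine hint (2 * θ + (|G| + |L|)) (by fun_prop) fun x => ?_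
      have h1 : |⟪x, EuclideanSpace.single i (1 : ℝ)⟫_ℝ| ≤ ‖x‖ := by
        simpa using abs_real_inner_le_norm x (EuclideanSpace.single i (1 : ℝ))
      have h2 : |fderiv ℝ V x (EuclideanSpace.single i 1)| ≤ ‖gradient V x‖ := by
        rw [fderiv_apply_eq_inner_gradient V]
        simpa using abs_real_inner_le_norm (EuclideanSpace.single i (1 : ℝ)) (gradient V x)
      rw [abs_mul]
      calc |x i| * |2 * θ * ⟪x, EuclideanSpace.single i (1 : ℝ)⟫_ℝ -
            fderiv ℝ V x (EuclideanSpace.single i 1)|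
          ≤ ‖x‖ * (2 * θ * ‖x‖ + ‖gradient V x‖) := by
            gcongr
            · exact hcoord x i
            · refine (abs_sub _ _).trans ?_
              rw [abs_mul, abs_of_pos (by positivity : 0 < 2 * θ)]
              gcongr
        _ = 2 * θ * ‖x‖ ^ 2 + ‖x‖ * ‖gradient V x‖ := by ring
        _ ≤ 2 * θ * (1 + ‖x‖ ^ 2) + (|G| + |L|) * (1 + ‖x‖ ^ 2) := by
            refine add_le_add ?_ (hbound x)
            gcongr
            linarith
        _ = _ := by ring)
  simp_rw [hg', real_inner_self_eq_norm_sq] at hdiv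
  rw [← sub_eq_zero, ← integral_sub hI2 hI3]
  have hsplit : ∀ x, fderiv ℝ V x x * Real.exp (θ * ‖x‖ ^ 2 - V x) -
      ((d : ℝ) + 2 * θ * ‖x‖ ^ 2) * Real.exp (θ * ‖x‖ ^ 2 - V x) =
      -((2 * θ * ‖x‖ ^ 2 - fderiv ℝ V x x) * Real.exp (θ * ‖x‖ ^ 2 - V x) +
        d * Real.exp (θ * ‖x‖ ^ 2 - V x)) := fun x => by ring
  have hI4 : Integrable fun x => (2 * θ * ‖x‖ ^ 2 - fderiv ℝ V x x) *
      Real.exp (θ * ‖x‖ ^ 2 - V x) := by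
    refine ((hI3.sub hI2).sub (hI1.const_mul (d : ℝ))).congr
      (Filter.Eventually.of_forall fun x => ?_)
    simp only [Pi.sub_apply]
    ring
  simp_rw [hsplit]
  rw [integral_neg, integral_add hI4 (hI1.const_mul _), hdiv, integral_const_mul]
  ring
end

section
/- Let V : ℝ^d → ℝ be continuously differentiable with ⟨x, ∇V(x)⟩ ≥ c‖x‖² - C for all x (where c > 0, C ≥ 0) and ‖∇V(x)‖ ≤ G + L‖x‖ for all x, and let μ be the Gibbs probability measure with density proportional to e^{-V}. Then for every θ with 0 < θ < c/2, ∫ e^{θ‖x‖²} dμ(x) ≤ (1 - 2θ/c)^{-(d + C)/2}. -/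
open MeasureTheory
open scoped InnerProductSpace

/-- Integrating radial dissipativity along a ray. -/
theorem radial_growth_of_dissipative {E : Type*} [NormedAddCommGroup E] [InnerProductSpace ℝ E]
    [CompleteSpace E] {V : E → ℝ} (hV : Differentiable ℝ V) {c C : ℝ}
    (hdiss : ∀ x : E, ⟪x, gradient V x⟫_ℝ ≥ c * ‖x‖ ^ 2 - C) {R : ℝ} (hR : 1 ≤ R) (y : E) :
    V y + c * ‖y‖ ^ 2 * (R ^ 2 - 1) / 2 - C * Real.log R ≤ V (R • y) := by
  have hder : ∀ s : ℝ, 0 < s →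
      HasDerivAt (fun s : ℝ => V (s • y) - c * ‖y‖ ^ 2 * s ^ 2 / 2 + C * Real.log s)
        (⟪gradient V (s • y), y⟫_ℝ - c * ‖y‖ ^ 2 * s + C * s⁻¹) s := by
    intro s hs
    have h1 : HasDerivAt (fun s : ℝ => V (s • y)) ⟪gradient V (s • y), y⟫_ℝ s := by
      have h := (hV (s • y)).hasGradientAt.hasFDerivAt.comp_hasDerivAt s
        ((hasDerivAt_id s).smul_const y)
      exact h.congr_deriv (by simp)
    have h2 : HasDerivAt (fun s : ℝ => c * ‖y‖ ^ 2 * s ^ 2 / 2) (c * ‖y‖ ^ 2 * s) s := by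
      exact (((hasDerivAt_pow 2 s).const_mul (c * ‖y‖ ^ 2)).div_const 2).congr_deriv
        (by push_cast; ring)
    exact (h1.sub h2).add ((Real.hasDerivAt_log hs.ne').const_mul C)
  have hmono : MonotoneOn
      (fun s : ℝ => V (s • y) - c * ‖y‖ ^ 2 * s ^ 2 / 2 + C * Real.log s) (Set.Ici 1) := by
    have hpos : ∀ s ∈ Set.Ici (1 : ℝ), 0 < s := fun s hs => zero_lt_one.trans_le hs
    refine monotoneOn_of_deriv_nonneg (convex_Ici 1)
      (fun s hs => (hder s (hpos s hs)).continuousAt.continuousWithinAt)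
      (fun s hs => (hder s (hpos s (interior_subset hs))).differentiableAt.differentiableWithinAt)
      fun s hs => ?_
    have hs0 := hpos s (interior_subset hs)
    rw [(hder s hs0).deriv]
    have h := hdiss (s • y)
    rw [real_inner_smul_left, norm_smul, mul_pow, Real.norm_eq_abs, sq_abs,
      real_inner_comm] at h
    have h3 : ⟪gradient V (s • y), y⟫_ℝ - c * ‖y‖ ^ 2 * s + C * s⁻¹
        = (s * ⟪gradient V (s • y), y⟫_ℝ - c * (s ^ 2 * ‖y‖ ^ 2) + C) / s := by
      field_simp
    rw [h3]
    exact div_nonneg (by linarith) hs0.le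
  have h := hmono Set.self_mem_Ici (Set.mem_Ici.2 hR) hR
  simp only [one_smul, Real.log_one] at h
  linarith

/-- Dilating by `R = (1 - 2θ/c)^(-1/2)` absorbs the Gaussian weight into the potential. -/
theorem integral_exp_sub_le_of_dissipative {d : ℕ} {V : EuclideanSpace ℝ (Fin d) → ℝ}
    (hV : Differentiable ℝ V) {c C θ : ℝ} (hc : 0 < c)
    (hdiss : ∀ x : EuclideanSpace ℝ (Fin d), ⟪x, gradient V x⟫_ℝ ≥ c * ‖x‖ ^ 2 - C)
    (hint : Integrable fun x => Real.exp (-V x)) (hθ1 : 0 < θ) (hθ2 : θ < c / 2) :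
    ∫ x, Real.exp (θ * ‖x‖ ^ 2 - V x)
      ≤ (1 - 2 * θ / c) ^ (-(((d : ℝ) + C) / 2)) * ∫ x, Real.exp (-V x) := by
  have ha : 0 < 1 - 2 * θ / c := by
    rw [sub_pos, div_lt_one hc]
    linarith
  have ha1 : 1 - 2 * θ / c ≤ 1 := by
    have : 0 < 2 * θ / c := by positivity
    linarith
  set a := 1 - 2 * θ / c with ha_def
  have hθ : θ = c / 2 * (1 - a) := by
    rw [ha_def]
    field_simp
    ring
  set R : ℝ := a ^ (-(1 / 2) : ℝ) with hR_def
  have hR0 : 0 < R := Real.rpow_pos_of_pos ha _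
  have hR1 : 1 ≤ R := Real.one_le_rpow_of_pos_of_le_one_of_nonpos ha ha1 (by norm_num)
  have hR2 : a * R ^ 2 = 1 := by
    rw [hR_def, ← Real.rpow_natCast, ← Real.rpow_mul ha.le]
    norm_num
    rw [Real.rpow_neg_one, mul_inv_cancel₀ ha.ne']
  have hpt : ∀ y : EuclideanSpace ℝ (Fin d),
      Real.exp (θ * ‖R • y‖ ^ 2 - V (R • y)) ≤ R ^ C * Real.exp (-V y) := by
    intro y
    rw [Real.rpow_def_of_pos hR0, ← Real.exp_add, Real.exp_le_exp, norm_smul, mul_pow,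
      Real.norm_eq_abs, sq_abs]
    have h := radial_growth_of_dissipative hV hdiss hR1 y
    have h2 : θ * (R ^ 2 * ‖y‖ ^ 2) = c * ‖y‖ ^ 2 * (R ^ 2 - 1) / 2 := by
      rw [hθ]
      linear_combination (-(c / 2 * ‖y‖ ^ 2)) * hR2
    linarith
  have hscale := Measure.integral_comp_smul (volume : Measure (EuclideanSpace ℝ (Fin d)))
    (fun x => Real.exp (θ * ‖x‖ ^ 2 - V x)) R
  rw [finrank_euclideanSpace_fin, abs_of_nonneg (by positivity), smul_eq_mul,
    eq_inv_mul_iff_mul_eq₀ (by positivity)] at hscale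
  have hexp : R ^ d * R ^ C = a ^ (-(((d : ℝ) + C) / 2)) := by
    rw [← Real.rpow_natCast, ← Real.rpow_add hR0, hR_def, ← Real.rpow_mul ha.le]
    congr 1
    ring
  rw [← hscale, ← hexp, mul_assoc]
  refine mul_le_mul_of_nonneg_left ?_ (by positivity)
  rw [← integral_const_mul]
  exact integral_mono_of_nonneg (.of_forall fun y => (Real.exp_pos _).le)
    (hint.const_mul _) (.of_forall hpt)

theorem stmt_7 {d : ℕ} (V : EuclideanSpace ℝ (Fin d) → ℝ) (hV : ContDiff ℝ 1 V)
    (c C G L : ℝ) (hc : 0 < c) (hC : 0 ≤ C)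
    (hdiss : ∀ x : EuclideanSpace ℝ (Fin d), ⟪x, gradient V x⟫_ℝ ≥ c * ‖x‖ ^ 2 - C)
    (hgrow : ∀ x : EuclideanSpace ℝ (Fin d), ‖gradient V x‖ ≤ G + L * ‖x‖)
    (μ : Measure (EuclideanSpace ℝ (Fin d)))
    (hμ : μ = volume.withDensity fun x =>
      ENNReal.ofReal (Real.exp (-V x) / ∫ y : EuclideanSpace ℝ (Fin d), Real.exp (-V y)))
    (θ : ℝ) (hθ1 : 0 < θ) (hθ2 : θ < c / 2) :
    ∫ x, Real.exp (θ * ‖x‖ ^ 2) ∂μ ≤ (1 - 2 * θ / c) ^ (-(((d : ℝ) + C) / 2)) := by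
  have ha : 0 ≤ 1 - 2 * θ / c := by
    rw [sub_nonneg, div_le_one hc]
    linarith
  have hrhs : 0 ≤ (1 - 2 * θ / c) ^ (-(((d : ℝ) + C) / 2)) := Real.rpow_nonneg ha _
  by_cases hint : Integrable fun x => Real.exp (-V x)
  · have hVc := hV.continuous
    have hZ : 0 ≤ ∫ y, Real.exp (-V y) := integral_nonneg fun y => (Real.exp_pos _).le
    set Z := ∫ y, Real.exp (-V y) with hZ_def
    have hmeas : Measurable fun x => ENNReal.ofReal (Real.exp (-V x) / Z) :=
      (by fun_prop : Continuous fun x => Real.exp (-V x) / Z).measurable.ennreal_ofReal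
    have heq : ∫ x, Real.exp (θ * ‖x‖ ^ 2) ∂μ = (∫ x, Real.exp (θ * ‖x‖ ^ 2 - V x)) / Z := by
      rw [hμ, integral_withDensity_eq_integral_toReal_smul hmeas
        (.of_forall fun _ => ENNReal.ofReal_lt_top), ← integral_div]
      congr 1 with x
      rw [ENNReal.toReal_ofReal (div_nonneg (Real.exp_pos _).le hZ), smul_eq_mul,
        sub_eq_add_neg, Real.exp_add]
      ring
    rw [heq]
    exact div_le_of_le_mul₀ hZ hrhs
      (integral_exp_sub_le_of_dissipative (hV.differentiable one_ne_zero) hc hdiss hint hθ1 hθ2)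
  · have hμ0 : μ = 0 := by
      rw [hμ, integral_undef hint]
      simp
    simpa [hμ0] using hrhs
end

section
/- Let V : ℝ^d → ℝ be continuously differentiable with ⟨x, ∇V(x)⟩ ≥ c‖x‖² - C for all x (c > 0, C ≥ 0) and ‖∇V(x)‖ ≤ G + L‖x‖. Fix λ ≥ 0 and z ∈ ℝ^d, and let X be distributed according to the probability density proportional to exp(-V(x) - λ‖x - z‖²). Then (c + λ)·E[‖X‖²] ≤ d + C + λ‖z‖², and consequently E[‖X‖] ≤ ((d + C)/c)^{1/2} + ‖z‖. -/
open MeasureTheory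
open scoped InnerProductSpace

/-- A `C¹` function that is radially dissipative with constants `(c, C)` grows at least like
`c / 4 * ‖x‖ ^ 2`. -/
theorem exists_quadratic_lower_bound_of_dissipative_s9 {E : Type*} [NormedAddCommGroup E]
    [InnerProductSpace ℝ E] [FiniteDimensional ℝ E] [CompleteSpace E] {V : E → ℝ}
    (hV : ContDiff ℝ 1 V) {c C : ℝ} (hc : 0 < c) (hC : 0 ≤ C)
    (hdiss : ∀ x, c * ‖x‖ ^ 2 - C ≤ ⟪x, gradient V x⟫_ℝ) :
    ∃ m : ℝ, ∀ x, c / 4 * ‖x‖ ^ 2 + m ≤ V x := by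
  set R : ℝ := 1 + 2 * C / c with hR
  have hCc : 0 ≤ 2 * C / c := by positivity
  have hR1 : 1 ≤ R := by linarith
  have hRC : 2 * C ≤ c * R ^ 2 := by
    have h1 : c * R = c + 2 * C := by rw [hR]; field_simp
    nlinarith
  have hcont : Continuous fun x => V x - c / 4 * ‖x‖ ^ 2 := by
    have := hV.continuous
    fun_prop
  obtain ⟨y, -, hy⟩ := (isCompact_closedBall (0 : E) R).exists_isMinOn
    ⟨0, by simp; linarith⟩ hcont.continuousOn
  have hmin : ∀ x, ‖x‖ ≤ R → V y - c / 4 * ‖y‖ ^ 2 ≤ V x - c / 4 * ‖x‖ ^ 2 := fun x hx =>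
    isMinOn_iff.mp hy x (by simpa using hx)
  refine ⟨V y - c / 4 * ‖y‖ ^ 2, fun x => ?_⟩
  rcases le_total ‖x‖ R with hx | hx
  · linarith [hmin x hx]
  have hx0 : 0 < ‖x‖ := by linarith
  have hderiv : ∀ t : ℝ, HasDerivAt (fun t : ℝ => V (t • x) - c / 4 * (t ^ 2 * ‖x‖ ^ 2))
      (⟪gradient V (t • x), x⟫_ℝ - c / 2 * (t * ‖x‖ ^ 2)) t := by
    intro t
    have h1 : HasFDerivAt V (fderiv ℝ V (t • x)) (t • x) :=
      (hV.differentiable one_ne_zero _).hasFDerivAt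
    have h2 : HasDerivAt (fun t : ℝ => t • x) x t := by
      simpa using (hasDerivAt_id t).smul_const x
    have h3 := h1.comp_hasDerivAt t h2
    have h4 := (((hasDerivAt_pow 2 t).mul_const (‖x‖ ^ 2)).const_mul (c / 4))
    convert! h3.sub h4 using 1
    rw [inner_gradient_left]
    simp
    ring
  have hs1 : R / ‖x‖ ≤ 1 := by rw [div_le_one hx0]; exact hx
  have hs0 : 0 < R / ‖x‖ := by positivity
  have hmono := monotoneOn_of_deriv_nonneg (convex_Icc (R / ‖x‖) 1)
    (fun t _ => (hderiv t).continuousAt.continuousWithinAt)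
    (fun t _ => (hderiv t).differentiableAt.differentiableWithinAt) (by
      intro t ht
      rw [interior_Icc] at ht
      rw [(hderiv t).deriv]
      have ht0 : 0 < t := hs0.trans ht.1
      have htx : R ≤ t * ‖x‖ := by
        have := ht.1
        rw [div_lt_iff₀ hx0] at this
        exact this.le
      have hd := hdiss (t • x)
      rw [real_inner_smul_left, norm_smul, Real.norm_of_nonneg ht0.le,
        real_inner_comm] at hd
      refine nonneg_of_mul_nonneg_right ?_ ht0
      have : c * R ^ 2 ≤ c * (t * ‖x‖) ^ 2 := by gcongr
      nlinarith)
  have h := hmono (Set.left_mem_Icc.mpr hs1) (Set.right_mem_Icc.mpr hs1) hs1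
  have hn : ‖(R / ‖x‖) • x‖ = R := by
    rw [norm_smul, Real.norm_of_nonneg hs0.le]
    field_simp
  have h' := hmin _ hn.le
  rw [norm_smul, Real.norm_of_nonneg hs0.le, mul_pow] at h'
  simp only [one_smul, one_pow, one_mul] at h
  linarith

theorem integrable_exp_neg_mul_norm_sq_s9 {E : Type*} [NormedAddCommGroup E]
    [InnerProductSpace ℝ E] [FiniteDimensional ℝ E] [MeasurableSpace E] [BorelSpace E]
    {a : ℝ} (ha : 0 < a) : Integrable fun x : E => Real.exp (-a * ‖x‖ ^ 2) := by
  have h := (GaussianFourier.integrable_cexp_neg_mul_sq_norm_add (V := E) (b := (a : ℂ))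
    (by simpa using ha) 0 0).norm
  refine h.congr (.of_forall fun x => ?_)
  simp [Complex.norm_exp, ← Complex.ofReal_pow]

theorem integrable_one_add_norm_sq_mul_exp {E : Type*} [NormedAddCommGroup E]
    [InnerProductSpace ℝ E] [FiniteDimensional ℝ E] [MeasurableSpace E] [BorelSpace E]
    {a : ℝ} (ha : 0 < a) :
    Integrable fun x : E => (1 + ‖x‖ ^ 2) * Real.exp (-a * ‖x‖ ^ 2) := by
  refine ((integrable_exp_neg_mul_norm_sq_s9 (E := E) (half_pos ha)).const_mul (1 + 2 / a)).mono'
    (by fun_prop) (.of_forall fun x => ?_)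
  rw [Real.norm_of_nonneg (by positivity)]
  have h1 : 1 + ‖x‖ ^ 2 ≤ (1 + 2 / a) * Real.exp (a / 2 * ‖x‖ ^ 2) := by
    have h2 := Real.add_one_le_exp (a / 2 * ‖x‖ ^ 2)
    have h3 : (1 + 2 / a) * (a / 2 * ‖x‖ ^ 2 + 1)
        = 1 + ‖x‖ ^ 2 + (a / 2 * ‖x‖ ^ 2 + 2 / a) := by field_simp; ring
    have h4 : 0 ≤ a / 2 * ‖x‖ ^ 2 + 2 / a := by positivity
    have h5 : 0 ≤ 1 + 2 / a := by positivity
    nlinarith [mul_le_mul_of_nonneg_left h2 h5]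
  calc (1 + ‖x‖ ^ 2) * Real.exp (-a * ‖x‖ ^ 2)
      ≤ (1 + 2 / a) * Real.exp (a / 2 * ‖x‖ ^ 2) * Real.exp (-a * ‖x‖ ^ 2) := by gcongr
    _ = (1 + 2 / a) * Real.exp (-(a / 2) * ‖x‖ ^ 2) := by
      rw [mul_assoc, ← Real.exp_add]
      ring_nf

/-- Integration by parts against the Euler field `x ↦ x`, whose divergence is the dimension. -/
theorem integral_fderiv_apply_self_s9 {d : ℕ} {w : EuclideanSpace ℝ (Fin d) → ℝ}
    (hw : ContDiff ℝ 1 w) (hint : Integrable w) (hint₁ : Integrable fun x => ‖x‖ * w x)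
    (hint' : Integrable fun x => ‖x‖ * ‖fderiv ℝ w x‖) :
    ∫ x, fderiv ℝ w x x = -(d * ∫ x, w x) := by
  have hcw := hw.continuous
  have hcw' := hw.continuous_fderiv one_ne_zero
  let e : Fin d → EuclideanSpace ℝ (Fin d) := fun i => EuclideanSpace.single i 1
  have hdx : ∀ i x, fderiv ℝ (fun x : EuclideanSpace ℝ (Fin d) => x i) x (e i) = 1 := by
    intro i x
    have : HasFDerivAt (fun x : EuclideanSpace ℝ (Fin d) => x i)
        (EuclideanSpace.proj i : EuclideanSpace ℝ (Fin d) →L[ℝ] ℝ) x :=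
      (EuclideanSpace.proj i : EuclideanSpace ℝ (Fin d) →L[ℝ] ℝ).hasFDerivAt
    rw [this.fderiv]
    simp [e]
  have hI : ∀ i, Integrable fun x : EuclideanSpace ℝ (Fin d) => x i * fderiv ℝ w x (e i) := by
    intro i
    refine hint'.mono' (by fun_prop) (.of_forall fun x => ?_)
    rw [norm_mul]
    have h1 := (fderiv ℝ w x).le_opNorm (e i)
    have h2 : ‖e i‖ = 1 := by simp [e]
    rw [h2, mul_one] at h1
    exact mul_le_mul (PiLp.norm_apply_le x i) h1 (norm_nonneg _) (norm_nonneg _)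
  have hibp : ∀ i, ∫ x : EuclideanSpace ℝ (Fin d), x i * fderiv ℝ w x (e i) = -∫ x, w x := by
    intro i
    rw [integral_mul_fderiv_eq_neg_fderiv_mul_of_integrable]
    · simp [hdx]
    · simpa [hdx] using hint
    · exact hI i
    · refine hint₁.norm.mono' (by fun_prop) (.of_forall fun x => ?_)
      rw [norm_mul, norm_mul, norm_norm]
      gcongr
      exact PiLp.norm_apply_le x i
    · intro x _
      fun_prop
    · exact fun x _ => hw.differentiable one_ne_zero x
  have hsum : ∀ x : EuclideanSpace ℝ (Fin d),
      fderiv ℝ w x x = ∑ i, x i * fderiv ℝ w x (e i) := by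
    intro x
    have hx : x = ∑ i, x i • e i := by
      simpa [e] using ((EuclideanSpace.basisFun (Fin d) ℝ).sum_repr x).symm
    conv_lhs => enter [2]; rw [hx]
    simp
  simp_rw [hsum]
  rw [integral_finsetSum _ fun i _ => hI i]
  simp [hibp]

theorem stmt_9 {d : ℕ} (V : EuclideanSpace ℝ (Fin d) → ℝ) (hV : ContDiff ℝ 1 V)
    (c C G L : ℝ) (hc : 0 < c) (hC : 0 ≤ C)
    (hdiss : ∀ x : EuclideanSpace ℝ (Fin d), ⟪x, gradient V x⟫_ℝ ≥ c * ‖x‖ ^ 2 - C)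
    (hgrow : ∀ x : EuclideanSpace ℝ (Fin d), ‖gradient V x‖ ≤ G + L * ‖x‖)
    (lam : ℝ) (hlam : 0 ≤ lam) (z : EuclideanSpace ℝ (Fin d))
    (μ : Measure (EuclideanSpace ℝ (Fin d)))
    (hμ : μ = volume.withDensity fun x =>
      ENNReal.ofReal (Real.exp (-(V x + lam * ‖x - z‖ ^ 2)) /
        ∫ y : EuclideanSpace ℝ (Fin d), Real.exp (-(V y + lam * ‖y - z‖ ^ 2)))) :
    (c + lam) * ∫ x, ‖x‖ ^ 2 ∂μ ≤ (d : ℝ) + C + lam * ‖z‖ ^ 2 ∧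
    ∫ x, ‖x‖ ∂μ ≤ Real.sqrt (((d : ℝ) + C) / c) + ‖z‖ := by
  set w : EuclideanSpace ℝ (Fin d) → ℝ :=
    fun x => Real.exp (-(V x + lam * ‖x - z‖ ^ 2)) with hw
  have hwpos : ∀ x, 0 < w x := fun x => Real.exp_pos _
  have hwC : ContDiff ℝ 1 w :=
    (hV.add (contDiff_const.mul ((contDiff_id.sub contDiff_const).norm_sq ℝ))).neg.exp
  have hcw := hwC.continuous
  have hcw' := hwC.continuous_fderiv one_ne_zero
  obtain ⟨m, hm⟩ := exists_quadratic_lower_bound_of_dissipative_s9 hV hc hC hdiss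
  have hwle : ∀ x, w x ≤ Real.exp (-m) * Real.exp (-(c / 4) * ‖x‖ ^ 2) := by
    intro x
    rw [← Real.exp_add, hw]
    refine Real.exp_le_exp.mpr ?_
    have : 0 ≤ lam * ‖x - z‖ ^ 2 := by positivity
    linarith [hm x]
  have hint2 : Integrable fun x => (1 + ‖x‖ ^ 2) * w x := by
    refine ((integrable_one_add_norm_sq_mul_exp (E := EuclideanSpace ℝ (Fin d))
      (show 0 < c / 4 by positivity)).const_mul (Real.exp (-m))).mono'
      (by fun_prop) (.of_forall fun x => ?_)
    have := hwpos x
    rw [Real.norm_of_nonneg (by positivity), mul_left_comm]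
    exact mul_le_mul_of_nonneg_left (hwle x) (by positivity)
  have hdom : ∀ {f : EuclideanSpace ℝ (Fin d) → ℝ} (K : ℝ), Continuous f →
      (∀ x, ‖f x‖ ≤ K * (1 + ‖x‖ ^ 2) * w x) → Integrable f := by
    intro f K hf hK
    refine (hint2.const_mul K).mono' hf.aestronglyMeasurable (.of_forall fun x => ?_)
    rw [← mul_assoc]
    exact hK x
  have hI0 : Integrable w := hdom 1 hcw fun x => by
    rw [Real.norm_of_nonneg (hwpos x).le]
    nlinarith [hwpos x, mul_nonneg (sq_nonneg ‖x‖) (hwpos x).le]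
  have hI1 : Integrable fun x => ‖x‖ * w x := hdom 1 (by fun_prop) fun x => by
    rw [Real.norm_of_nonneg (mul_nonneg (norm_nonneg _) (hwpos x).le)]
    refine mul_le_mul_of_nonneg_right ?_ (hwpos x).le
    nlinarith [sq_nonneg (‖x‖ - 1), sq_nonneg ‖x‖]
  have hI2 : Integrable fun x => ‖x‖ ^ 2 * w x := hdom 1 (by fun_prop) fun x => by
    rw [Real.norm_of_nonneg (mul_nonneg (sq_nonneg _) (hwpos x).le)]
    exact mul_le_mul_of_nonneg_right (by linarith) (hwpos x).le
  have hfd : ∀ x v, fderiv ℝ w x v =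
      -(w x * (⟪gradient V x, v⟫_ℝ + 2 * lam * ⟪x - z, v⟫_ℝ)) := by
    intro x v
    have h1 : HasFDerivAt V (fderiv ℝ V x) x :=
      (hV.differentiable one_ne_zero _).hasFDerivAt
    have h2 := (((hasFDerivAt_id x).sub_const z).norm_sq).const_mul lam
    have h3 := ((h1.add h2).neg).exp
    have h4 : HasFDerivAt w _ x := h3
    rw [h4.fderiv, inner_gradient_left]
    simp [hw, inner_sub_left]
    ring
  have hfdn : ∀ x, ‖fderiv ℝ w x‖ ≤
      (|G| + |L| * ‖x‖ + 2 * lam * (‖x‖ + ‖z‖)) * w x := by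
    intro x
    have := hwpos x
    refine ContinuousLinearMap.opNorm_le_bound _ (by positivity) fun v => ?_
    rw [hfd, norm_neg, norm_mul, Real.norm_of_nonneg this.le]
    have h1 : ‖⟪gradient V x, v⟫_ℝ‖ ≤ (|G| + |L| * ‖x‖) * ‖v‖ :=
      (norm_inner_le_norm _ _).trans (mul_le_mul_of_nonneg_right ((hgrow x).trans
        (add_le_add (le_abs_self _)
          (mul_le_mul_of_nonneg_right (le_abs_self _) (norm_nonneg _)))) (norm_nonneg _))
    have h2 : ‖⟪x - z, v⟫_ℝ‖ ≤ (‖x‖ + ‖z‖) * ‖v‖ :=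
      (norm_inner_le_norm _ _).trans (mul_le_mul_of_nonneg_right (norm_sub_le _ _)
        (norm_nonneg _))
    have h3 : ‖⟪gradient V x, v⟫_ℝ + 2 * lam * ⟪x - z, v⟫_ℝ‖ ≤
        (|G| + |L| * ‖x‖) * ‖v‖ + 2 * lam * ((‖x‖ + ‖z‖) * ‖v‖) := by
      refine (norm_add_le _ _).trans (add_le_add h1 ?_)
      rw [norm_mul, Real.norm_of_nonneg (by positivity : 0 ≤ 2 * lam)]
      gcongr
    calc w x * ‖⟪gradient V x, v⟫_ℝ + 2 * lam * ⟪x - z, v⟫_ℝ‖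
        ≤ w x * ((|G| + |L| * ‖x‖) * ‖v‖ + 2 * lam * ((‖x‖ + ‖z‖) * ‖v‖)) := by gcongr
      _ = _ := by ring
  have hI' : Integrable fun x => ‖x‖ * ‖fderiv ℝ w x‖ :=
    hdom (|G| + |L| + 2 * lam * (1 + ‖z‖)) (by fun_prop) fun x => by
      rw [norm_mul, norm_norm, norm_norm]
      refine (mul_le_mul_of_nonneg_left (hfdn x) (norm_nonneg x)).trans ?_
      rw [← mul_assoc]
      refine mul_le_mul_of_nonneg_right ?_ (hwpos x).le
      have hx1 : ‖x‖ ≤ 1 + ‖x‖ ^ 2 := by nlinarith [sq_nonneg (‖x‖ - 1), sq_nonneg ‖x‖]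
      have hx2 : ‖x‖ ^ 2 ≤ 1 + ‖x‖ ^ 2 := by linarith
      calc ‖x‖ * (|G| + |L| * ‖x‖ + 2 * lam * (‖x‖ + ‖z‖))
          = |G| * ‖x‖ + |L| * ‖x‖ ^ 2 + 2 * lam * (‖x‖ ^ 2 + ‖z‖ * ‖x‖) := by ring
        _ ≤ |G| * (1 + ‖x‖ ^ 2) + |L| * (1 + ‖x‖ ^ 2)
            + 2 * lam * ((1 + ‖x‖ ^ 2) + ‖z‖ * (1 + ‖x‖ ^ 2)) := by gcongr
        _ = _ := by ring
  have hibp := integral_fderiv_apply_self_s9 hwC hI0 hI1 hI'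
  set Z : ℝ := ∫ y, w y with hZ
  have hZpos : 0 < Z := by
    rw [hZ, integral_pos_iff_support_of_nonneg (fun x => (hwpos x).le) hI0]
    have : Function.support w = Set.univ := Set.eq_univ_of_forall fun x => (hwpos x).ne'
    rw [this]
    exact NeZero.pos _
  have hmom : (c + lam) * ∫ x, ‖x‖ ^ 2 * w x ≤ (d + C + lam * ‖z‖ ^ 2) * Z := by
    have hle : ∫ x, ((c + lam) * (‖x‖ ^ 2 * w x) - (C + lam * ‖z‖ ^ 2) * w x) ≤
        ∫ x, -fderiv ℝ w x x := by
      refine integral_mono ((hI2.const_mul _).sub (hI0.const_mul _)) ?_ fun x => ?_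
      · refine (hI'.mono' (by fun_prop) (.of_forall fun x => ?_)).neg
        rw [mul_comm]
        exact (fderiv ℝ w x).le_opNorm x
      · have h1 := hdiss x
        have h2 : ⟪x - z, x⟫_ℝ = ‖x‖ ^ 2 - ⟪z, x⟫_ℝ := by
          rw [inner_sub_left, real_inner_self_eq_norm_sq]
        have h3 := norm_sub_sq_real z x
        have h4 := sq_nonneg ‖z - x‖
        have h5 : ‖x‖ ^ 2 - ‖z‖ ^ 2 ≤ 2 * ⟪x - z, x⟫_ℝ := by linarith
        have h6 := mul_le_mul_of_nonneg_left h5 hlam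
        rw [real_inner_comm] at h1
        have h7 : (c + lam) * ‖x‖ ^ 2 - (C + lam * ‖z‖ ^ 2) ≤
            ⟪gradient V x, x⟫_ℝ + 2 * lam * ⟪x - z, x⟫_ℝ := by linarith
        have h8 := mul_le_mul_of_nonneg_left h7 (hwpos x).le
        simp only [hfd, neg_neg]
        linarith
    rw [integral_neg, hibp, integral_sub (hI2.const_mul _) (hI0.const_mul _),
      integral_const_mul, integral_const_mul] at hle
    linarith
  have hμint : ∀ f : EuclideanSpace ℝ (Fin d) → ℝ, ∫ x, f x ∂μ = (∫ x, f x * w x) / Z := by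
    intro f
    have hcV := hV.continuous
    rw [hμ, integral_withDensity_eq_integral_toReal_smul (by fun_prop)
      (.of_forall fun x => ENNReal.ofReal_lt_top), ← integral_div]
    refine integral_congr_ae (.of_forall fun x => ?_)
    simp only [smul_eq_mul]
    rw [ENNReal.toReal_ofReal (div_nonneg (hwpos x).le hZpos.le)]
    ring
  have hfirst : (c + lam) * ∫ x, ‖x‖ ^ 2 ∂μ ≤ (d : ℝ) + C + lam * ‖z‖ ^ 2 := by
    rw [hμint, ← mul_div_assoc, div_le_iff₀ hZpos]
    exact hmom
  refine ⟨hfirst, ?_⟩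
  have hjensen : (∫ x, ‖x‖ ∂μ) ^ 2 ≤ ∫ x, ‖x‖ ^ 2 ∂μ := by
    set M := ∫ x, ‖x‖ ∂μ with hM
    have h0 : 0 ≤ ∫ x, (‖x‖ - M) ^ 2 * w x :=
      integral_nonneg fun x => mul_nonneg (sq_nonneg _) (hwpos x).le
    have hI21 : Integrable fun x => ‖x‖ ^ 2 * w x - 2 * M * (‖x‖ * w x) :=
      hI2.sub (hI1.const_mul (2 * M))
    have h1 : ∫ x, (‖x‖ - M) ^ 2 * w x =
        (∫ x, ‖x‖ ^ 2 * w x) - 2 * M * (∫ x, ‖x‖ * w x) + M ^ 2 * Z := by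
      rw [hZ, ← integral_const_mul (2 * M), ← integral_const_mul (M ^ 2),
        ← integral_sub hI2 (hI1.const_mul (2 * M)),
        ← integral_add hI21 (hI0.const_mul (M ^ 2))]
      refine integral_congr_ae (.of_forall fun x => ?_)
      simp only
      ring
    have h2 : ∫ x, ‖x‖ * w x = M * Z := by
      rw [hM, hμint]
      field_simp
    rw [hμint, le_div_iff₀ hZpos]
    rw [h1, h2] at h0
    linarith
  set A : ℝ := ((d : ℝ) + C) / c with hA
  have hA0 : 0 ≤ A := by positivity
  have hcA : c * A = d + C := by rw [hA]; field_simp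
  have hS : ∫ x, ‖x‖ ^ 2 ∂μ ≤ A + ‖z‖ ^ 2 := by
    refine le_of_mul_le_mul_left (hfirst.trans ?_) (by positivity : 0 < c + lam)
    nlinarith [mul_nonneg hlam hA0, mul_nonneg hc.le (sq_nonneg ‖z‖)]
  refine abs_le_of_sq_le_sq' ?_ (by positivity) |>.2
  nlinarith [Real.sq_sqrt hA0, mul_nonneg (Real.sqrt_nonneg A) (norm_nonneg z)]
end

section
/- Let Φ : ℝ^d → ℝ be continuously differentiable with ⟨x - y, ∇Φ(x) - ∇Φ(y)⟩ ≥ m‖x - y‖² - b for all x, y (m > 0, b ≥ 0) and ‖∇Φ(x)‖ ≤ G + L‖x‖. Let X and X' be independent random vectors each distributed according to the Gibbs density proportional to e^{-Φ}. Then for every real p ≥ 2, m · E[‖X - X'‖^p] ≤ (2(d + p - 2) + b) · E[‖X - X'‖^{p-2}], all moments involved being finite. -/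
open MeasureTheory
open scoped InnerProductSpace

section GibbsMoments

open Module

variable {E : Type*} [NormedAddCommGroup E]

lemma norm_sub_rpow_le_one_add_norm_pow {s : ℝ} (hs : 0 ≤ s) {n : ℕ} (hn : s ≤ n) (x y : E) :
    ‖x - y‖ ^ s ≤ (1 + ‖x‖) ^ n * (1 + ‖y‖) ^ n := by
  have hx := norm_nonneg x
  have hy := norm_nonneg y
  have h1 : ‖x - y‖ ≤ (1 + ‖x‖) * (1 + ‖y‖) := by nlinarith [norm_sub_le x y]
  have h2 : 1 ≤ (1 + ‖x‖) * (1 + ‖y‖) := by nlinarith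
  calc ‖x - y‖ ^ s ≤ ((1 + ‖x‖) * (1 + ‖y‖)) ^ s :=
        Real.rpow_le_rpow (norm_nonneg _) h1 hs
    _ ≤ ((1 + ‖x‖) * (1 + ‖y‖)) ^ (n : ℝ) := Real.rpow_le_rpow_of_exponent_le h2 hn
    _ = _ := by rw [Real.rpow_natCast, mul_pow]

lemma norm_rpow_sub_two_mul_sq {s : ℝ} (z : E) :
    s * (‖z‖ ^ (s - 2) * ‖z‖ ^ 2) = s * ‖z‖ ^ s := by
  rcases eq_or_ne z 0 with rfl | hz
  · rcases eq_or_ne s 0 with rfl | hs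
    · simp
    · simp [Real.zero_rpow hs]
  · rw [← Real.rpow_natCast, ← Real.rpow_add (norm_pos_iff.2 hz)]
    simp

lemma exists_norm_le_mul_one_add_norm {g : E → E} {G L : ℝ}
    (hgrow : ∀ x, ‖g x‖ ≤ G + L * ‖x‖) : ∃ A, 0 ≤ A ∧ ∀ x, ‖g x‖ ≤ A * (1 + ‖x‖) := by
  refine ⟨|G| + |L|, by positivity, fun x => (hgrow x).trans ?_⟩
  nlinarith [le_abs_self G, le_abs_self L, abs_nonneg G, abs_nonneg L, norm_nonneg x,
    mul_le_mul_of_nonneg_right (le_abs_self L) (norm_nonneg x),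
    mul_nonneg (abs_nonneg G) (norm_nonneg x)]

variable [InnerProductSpace ℝ E]

/-- The line derivative of a component of the vector field `z ↦ ‖z‖ ^ s • z`. -/
lemma hasLineDerivAt_norm_rpow_mul_inner {s : ℝ} (hs : 0 ≤ s) (v z : E) :
    HasLineDerivAt ℝ (fun z : E => ‖z‖ ^ s * ⟪v, z⟫_ℝ)
      (‖z‖ ^ s * ‖v‖ ^ 2 + s * (‖z‖ ^ (s - 2) * ⟪v, z⟫_ℝ ^ 2)) z v := by
  have hid : HasDerivAt (fun t : ℝ => z + t • v) v 0 := by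
    simpa using ((hasDerivAt_id (0 : ℝ)).smul_const v).const_add z
  have hinner : HasDerivAt (fun t : ℝ => ⟪v, z + t • v⟫_ℝ) (‖v‖ ^ 2) 0 := by
    simpa using (hasDerivAt_const (0 : ℝ) v).inner ℝ hid
  rcases eq_or_ne z 0 with rfl | hz
  · unfold HasLineDerivAt
    rw [hasDerivAt_iff_tendsto_slope]
    have hc : Continuous fun t : ℝ => ‖t • v‖ ^ s * ‖v‖ ^ 2 := by
      have : Continuous fun t : ℝ => ‖t • v‖ := by fun_prop
      exact (this.rpow_const fun _ => Or.inr hs).mul continuous_const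
    have ht := (hc.tendsto 0).mono_left (nhdsWithin_le_nhds (s := {(0 : ℝ)}ᶜ))
    simp only [zero_smul, inner_zero_right, ne_eq, OfNat.ofNat_ne_zero, not_false_eq_true,
      zero_pow, mul_zero, add_zero] at ht ⊢
    refine ht.congr' ?_
    filter_upwards [self_mem_nhdsWithin] with t ht
    have ht0 : t ≠ 0 := ht
    simp only [slope_def_field, zero_add, inner_smul_right, real_inner_self_eq_norm_sq,
      zero_smul, sub_zero]
    field_simp
    ring
  · have hn : HasDerivAt (fun t : ℝ => ‖z + t • v‖ ^ 2) (2 * ⟪z, v⟫_ℝ) 0 := by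
      simpa using hid.norm_sq
    have hpos : 0 < ‖z‖ := norm_pos_iff.2 hz
    have hr := (hn.rpow_const (p := s / 2) (Or.inl (by simpa using hz))).mul hinner
    have hsq : ∀ (w : E) (r : ℝ), (‖w‖ ^ 2) ^ (r / 2) = ‖w‖ ^ r := fun w r => by
      rw [← Real.rpow_natCast, ← Real.rpow_mul (norm_nonneg _)]
      congr 1
      push_cast
      ring
    have he : s / 2 - 1 = (s - 2) / 2 := by ring
    unfold HasLineDerivAt
    convert! hr using 1
    · funext t
      simp [hsq]
    · simp only [zero_smul, add_zero, he, hsq, real_inner_comm v z]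
      ring

lemma abs_norm_rpow_mul_add_le {s : ℝ} (hs : 0 ≤ s) (v z : E) :
    |‖z‖ ^ s * ‖v‖ ^ 2 + s * (‖z‖ ^ (s - 2) * ⟪v, z⟫_ℝ ^ 2)| ≤ (1 + s) * ‖v‖ ^ 2 * ‖z‖ ^ s := by
  have h1 : ⟪v, z⟫_ℝ ^ 2 ≤ ‖v‖ ^ 2 * ‖z‖ ^ 2 := by
    rw [← mul_pow, ← sq_abs]
    exact pow_le_pow_left₀ (abs_nonneg _) (abs_real_inner_le_norm v z) 2
  have h2 : 0 ≤ ‖z‖ ^ (s - 2) := Real.rpow_nonneg (norm_nonneg _) _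
  have h3 : 0 ≤ ‖z‖ ^ s := Real.rpow_nonneg (norm_nonneg _) _
  rw [abs_of_nonneg (by positivity)]
  calc _ ≤ ‖z‖ ^ s * ‖v‖ ^ 2 + s * (‖z‖ ^ (s - 2) * (‖v‖ ^ 2 * ‖z‖ ^ 2)) := by gcongr
    _ = ‖z‖ ^ s * ‖v‖ ^ 2 + ‖v‖ ^ 2 * (s * (‖z‖ ^ (s - 2) * ‖z‖ ^ 2)) := by ring
    _ = _ := by rw [norm_rpow_sub_two_mul_sq]; ring

variable [FiniteDimensional ℝ E]

/-- A potential that is dissipative with respect to the origin grows at least linearly. -/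
lemma exists_add_norm_le_of_dissipative {Φ : E → ℝ} (hΦ : ContDiff ℝ 1 Φ) {m b : ℝ} (hm : 0 < m)
    (hb : 0 ≤ b)
    (hdiss : ∀ x y : E, ⟪x - y, gradient Φ x - gradient Φ y⟫_ℝ ≥ m * ‖x - y‖ ^ 2 - b) :
    ∃ K : ℝ, ∀ x, K + ‖x‖ ≤ Φ x := by
  have hd : Differentiable ℝ Φ := hΦ.differentiable (by norm_num)
  set c := ‖gradient Φ 0‖ with hc
  set R := max 1 ((b + c + 1) / m) with hR
  have hR1 : 1 ≤ R := le_max_left _ _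
  have hR2 : b + c + 1 ≤ m * R := by
    have : (b + c + 1) / m ≤ R := le_max_right _ _
    rw [div_le_iff₀ hm] at this
    linarith
  obtain ⟨K, hK⟩ : ∃ K, ∀ x ∈ Metric.closedBall (0 : E) R, K ≤ Φ x := by
    obtain ⟨x₀, -, h⟩ := (isCompact_closedBall (0 : E) R).exists_isMinOn
      ⟨0, by simp; linarith⟩ hΦ.continuous.continuousOn
    exact ⟨Φ x₀, h⟩
  refine ⟨K - R, fun x => ?_⟩
  rcases le_or_gt ‖x‖ R with hx | hx
  · have := hK x (by simpa using hx)
    linarith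
  have hx0 : 0 < ‖x‖ := by linarith
  obtain ⟨u, hun, hux⟩ : ∃ u : E, ‖u‖ = 1 ∧ ‖x‖ • u = x :=
    ⟨‖x‖⁻¹ • x, by simp [norm_smul, hx0.ne'], by simp [smul_smul, hx0.ne']⟩
  have hder : ∀ r : ℝ, HasDerivAt (fun r : ℝ => Φ (r • u)) ⟪gradient Φ (r • u), u⟫_ℝ r := by
    intro r
    have h1 : HasDerivAt (fun r : ℝ => r • u) u r := by
      simpa using (hasDerivAt_id r).smul_const u
    exact (hd (r • u)).hasGradientAt.hasFDerivAt.comp_hasDerivAt r h1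
  have hge : ∀ r, R ≤ r → 1 ≤ ⟪gradient Φ (r • u), u⟫_ℝ := by
    intro r hr
    have h1 := hdiss (r • u) 0
    have h2 : ⟪u, gradient Φ 0⟫_ℝ ≥ -c := by
      have := abs_real_inner_le_norm u (gradient Φ 0)
      rw [hun, one_mul] at this
      exact (abs_le.1 this).1
    rw [sub_zero, inner_sub_right, inner_smul_left, inner_smul_left, norm_smul, hun,
      real_inner_comm] at h1
    simp only [conj_trivial, Real.norm_eq_abs, mul_one, sq_abs] at h1
    have hr1 : 1 ≤ r := hR1.trans hr
    have hmr : b + c + 1 ≤ m * r := hR2.trans (by gcongr)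
    have h3 : r * 1 ≤ r * ⟪gradient Φ (r • u), u⟫_ℝ := by nlinarith
    exact le_of_mul_le_mul_left h3 (by linarith)
  have hmv := (convex_Ici R).mul_sub_le_image_sub_of_le_deriv (f := fun r : ℝ => Φ (r • u))
    (fun r _ => (hder r).continuousAt.continuousWithinAt)
    (fun r _ => (hder r).differentiableAt.differentiableWithinAt) (C := 1)
    (fun r hr => by
      rw [(hder r).deriv]
      exact hge r (interior_subset hr)) R (by simp) ‖x‖ hx.le hx.le
  have hRu := hK (R • u) (by simp [norm_smul, hun, abs_of_nonneg (by linarith : (0 : ℝ) ≤ R)])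
  simp only [hux] at hmv
  linarith

lemma ContDiff.continuous_gradient {Φ : E → ℝ} (hΦ : ContDiff ℝ 1 Φ) :
    Continuous (gradient Φ) :=
  (InnerProductSpace.toDual ℝ E).symm.continuous.comp (hΦ.continuous_fderiv (by norm_num))

variable [MeasurableSpace E] [BorelSpace E]

lemma integrable_one_add_norm_pow_mul_exp_neg {Φ : E → ℝ} (hΦ : Continuous Φ) {K : ℝ}
    (hK : ∀ x, K + ‖x‖ ≤ Φ x) (n : ℕ) :
    Integrable fun x => (1 + ‖x‖) ^ n * Real.exp (-Φ x) := by
  set N := finrank ℝ E + 1 with hN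
  have hint : Integrable fun x : E => (1 + ‖x‖) ^ (-(N : ℝ)) :=
    integrable_one_add_norm (by rw [hN]; push_cast; linarith)
  refine (hint.const_mul (((n + N).factorial : ℝ) * Real.exp (1 - K))).mono'
    (by fun_prop) (Filter.Eventually.of_forall fun x => ?_)
  have hs : 0 < 1 + ‖x‖ := by positivity
  rw [Real.norm_of_nonneg (by positivity), Real.rpow_neg hs.le, Real.rpow_natCast,
    ← div_eq_mul_inv, le_div_iff₀ (by positivity)]
  have h1 := Real.pow_div_factorial_le_exp (1 + ‖x‖) hs.le (n + N)
  rw [div_le_iff₀ (by positivity)] at h1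
  calc (1 + ‖x‖) ^ n * Real.exp (-Φ x) * (1 + ‖x‖) ^ N
      = (1 + ‖x‖) ^ (n + N) * Real.exp (-Φ x) := by ring
    _ ≤ (Real.exp (1 + ‖x‖) * (n + N).factorial) * Real.exp (-K - ‖x‖) := by
        gcongr
        linarith [hK x]
    _ = (n + N).factorial * (Real.exp (1 + ‖x‖) * Real.exp (-K - ‖x‖)) := by ring
    _ = _ := by rw [← Real.exp_add]; congr 2; ring

lemma integrable_mul_exp_neg_of_le {Φ : E → ℝ} (hΦ : Continuous Φ)
    (hint : ∀ n : ℕ, Integrable fun x => (1 + ‖x‖) ^ n * Real.exp (-Φ x))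
    {h : E → ℝ} (hh : Measurable h) (C : ℝ) (n : ℕ) (hle : ∀ x, |h x| ≤ C * (1 + ‖x‖) ^ n) :
    Integrable fun x => h x * Real.exp (-Φ x) := by
  refine ((hint n).const_mul C).mono'
    (hh.mul (by fun_prop)).aestronglyMeasurable (Filter.Eventually.of_forall fun x => ?_)
  rw [norm_mul, Real.norm_eq_abs, Real.norm_of_nonneg (Real.exp_pos _).le, ← mul_assoc]
  gcongr
  exact hle x

/-- Integration by parts against the weight `exp (-Φ)` for the field `x ↦ ‖x - y‖ ^ s • (x - y)`. -/
lemma integral_norm_sub_rpow_mul_inner_gradient {Φ : E → ℝ} (hΦ : ContDiff ℝ 1 Φ)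
    (hint : ∀ n : ℕ, Integrable fun x => (1 + ‖x‖) ^ n * Real.exp (-Φ x))
    {A : ℝ} (hgrow : ∀ x, ‖gradient Φ x‖ ≤ A * (1 + ‖x‖))
    {s : ℝ} (hs : 0 ≤ s) (y : E) :
    ∫ x, ‖x - y‖ ^ s * ⟪x - y, gradient Φ x⟫_ℝ * Real.exp (-Φ x) =
      ∫ x, (finrank ℝ E + s) * ‖x - y‖ ^ s * Real.exp (-Φ x) := by
  have hd : Differentiable ℝ Φ := hΦ.differentiable (by norm_num)
  have hgc := hΦ.continuous_gradient
  have hgm := hgc.measurable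
  obtain ⟨n, hn⟩ := exists_nat_ge s
  set W := (1 + ‖y‖) ^ n
  have hW : 0 ≤ W := by positivity
  have hns : ∀ x, ‖x - y‖ ^ s ≤ W * (1 + ‖x‖) ^ n := fun x =>
    (norm_sub_rpow_le_one_add_norm_pow hs hn x y).trans_eq (mul_comm _ _)
  have hns0 : ∀ x : E, 0 ≤ ‖x - y‖ ^ s := fun x => Real.rpow_nonneg (norm_nonneg _) _
  have hsub : ∀ x, ‖x - y‖ ≤ (1 + ‖y‖) * (1 + ‖x‖) := fun x => by
    nlinarith [norm_sub_le x y, norm_nonneg x, norm_nonneg y]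
  set e := stdOrthonormalBasis ℝ E
  have hfb : ∀ i x, |‖x - y‖ ^ s * ⟪e i, x - y⟫_ℝ| ≤
      (W * (1 + ‖y‖)) * (1 + ‖x‖) ^ (n + 1) := by
    intro i x
    have h1 : |⟪e i, x - y⟫_ℝ| ≤ (1 + ‖y‖) * (1 + ‖x‖) := by
      have := abs_real_inner_le_norm (e i) (x - y)
      simp only [e.norm_eq_one, one_mul] at this
      exact this.trans (hsub x)
    rw [abs_mul, abs_of_nonneg (hns0 x)]
    calc _ ≤ (W * (1 + ‖x‖) ^ n) * ((1 + ‖y‖) * (1 + ‖x‖)) := by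
          gcongr
          exact hns x
      _ = _ := by ring
  have hgb : ∀ i x, |⟪gradient Φ x, e i⟫_ℝ| ≤ A * (1 + ‖x‖) := by
    intro i x
    have := abs_real_inner_le_norm (gradient Φ x) (e i)
    simp only [e.norm_eq_one, mul_one] at this
    exact this.trans (hgrow x)
  have I1 : ∀ i, Integrable fun x =>
      (‖x - y‖ ^ s * ‖e i‖ ^ 2 + s * (‖x - y‖ ^ (s - 2) * ⟪e i, x - y⟫_ℝ ^ 2)) *
        Real.exp (-Φ x) := by
    intro i
    refine integrable_mul_exp_neg_of_le hΦ.continuous hint (by fun_prop) ((1 + s) * W) n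
      fun x => ?_
    refine (abs_norm_rpow_mul_add_le hs (e i) (x - y)).trans ?_
    rw [e.norm_eq_one, one_pow, mul_one, mul_assoc]
    gcongr
    exact hns x
  have I2' : ∀ i, Integrable fun x =>
      (‖x - y‖ ^ s * ⟪e i, x - y⟫_ℝ * ⟪gradient Φ x, e i⟫_ℝ) * Real.exp (-Φ x) := by
    intro i
    refine integrable_mul_exp_neg_of_le hΦ.continuous hint (by fun_prop)
      (W * (1 + ‖y‖) * A) (n + 2) fun x => ?_
    rw [abs_mul]
    calc _ ≤ ((W * (1 + ‖y‖)) * (1 + ‖x‖) ^ (n + 1)) * (A * (1 + ‖x‖)) :=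
          mul_le_mul (hfb i x) (hgb i x) (abs_nonneg _) (by positivity)
      _ = _ := by ring
  have I2 : ∀ i, Integrable fun x =>
      ‖x - y‖ ^ s * ⟪e i, x - y⟫_ℝ * (-(⟪gradient Φ x, e i⟫_ℝ * Real.exp (-Φ x))) := by
    intro i
    refine (I2' i).neg.congr (Filter.Eventually.of_forall fun x => ?_)
    simp only [Pi.neg_apply]
    ring
  have I3 : ∀ i, Integrable fun x =>
      (‖x - y‖ ^ s * ⟪e i, x - y⟫_ℝ) * Real.exp (-Φ x) := fun i =>
    integrable_mul_exp_neg_of_le hΦ.continuous hint (by fun_prop) _ _ (hfb i)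
  have hpart : ∀ i, ∫ x, (‖x - y‖ ^ s * ⟪e i, x - y⟫_ℝ * ⟪gradient Φ x, e i⟫_ℝ) *
      Real.exp (-Φ x) = ∫ x, (‖x - y‖ ^ s * ‖e i‖ ^ 2 +
        s * (‖x - y‖ ^ (s - 2) * ⟪e i, x - y⟫_ℝ ^ 2)) * Real.exp (-Φ x) := by
    intro i
    have h := integral_bilinear_hasLineDerivAt_right_eq_neg_left_of_integrable
      (μ := (volume : Measure E)) (B := ContinuousLinearMap.mul ℝ ℝ) (v := e i)
      (f := fun x => ‖x - y‖ ^ s * ⟪e i, x - y⟫_ℝ)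
      (g := fun x => Real.exp (-Φ x)) (I1 i) (I2 i) (I3 i)
      (fun x _ => by
        have := hasLineDerivAt_norm_rpow_mul_inner hs (e i) (x - y)
        unfold HasLineDerivAt at this ⊢
        simpa only [sub_add_eq_add_sub] using this)
      (fun x _ => by
        have h1 := ((hd x).hasGradientAt.hasFDerivAt.hasLineDerivAt (e i)).neg.exp
        have h2 : -(⟪gradient Φ x, e i⟫_ℝ * Real.exp (-Φ x)) =
            Real.exp (-Φ (x + (0 : ℝ) • e i)) * -⟪gradient Φ x, e i⟫_ℝ := by
          rw [zero_smul, add_zero]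
          ring
        rw [h2]
        exact h1)
    simp only [ContinuousLinearMap.mul_apply'] at h
    rw [← neg_inj, ← h, ← integral_neg]
    congr 1
    funext x
    ring
  calc ∫ x, ‖x - y‖ ^ s * ⟪x - y, gradient Φ x⟫_ℝ * Real.exp (-Φ x)
      = ∫ x, ∑ i, (‖x - y‖ ^ s * ⟪e i, x - y⟫_ℝ * ⟪gradient Φ x, e i⟫_ℝ) *
          Real.exp (-Φ x) := by
        congr 1
        funext x
        rw [← e.sum_inner_mul_inner, Finset.mul_sum, Finset.sum_mul]
        refine Finset.sum_congr rfl fun i _ => ?_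
        rw [real_inner_comm (x - y) (e i), real_inner_comm (gradient Φ x) (e i)]
        ring
    _ = ∫ x, ∑ i, (‖x - y‖ ^ s * ‖e i‖ ^ 2 +
          s * (‖x - y‖ ^ (s - 2) * ⟪e i, x - y⟫_ℝ ^ 2)) * Real.exp (-Φ x) := by
        rw [integral_finsetSum _ fun i _ => I2' i, integral_finsetSum _ fun i _ => I1 i]
        exact Finset.sum_congr rfl fun i _ => hpart i
    _ = _ := by
        congr 1
        funext x
        rw [← Finset.sum_mul, Finset.sum_add_distrib, ← Finset.mul_sum, ← Finset.mul_sum,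
          ← Finset.mul_sum, e.sum_sq_inner_right, norm_rpow_sub_two_mul_sq]
        simp [e.norm_eq_one]
        ring

/-- The moment recursion for the distance between two independent samples of the Gibbs measure of a
two-point dissipative potential. -/
theorem integral_norm_sub_rpow_le_of_dissipative {Φ : E → ℝ} (hΦ : ContDiff ℝ 1 Φ)
    {m b G L : ℝ} (hm : 0 < m) (hb : 0 ≤ b)
    (hdiss : ∀ x y : E, ⟪x - y, gradient Φ x - gradient Φ y⟫_ℝ ≥ m * ‖x - y‖ ^ 2 - b)
    (hgrow : ∀ x : E, ‖gradient Φ x‖ ≤ G + L * ‖x‖) {Z : ℝ} (hZ : 0 ≤ Z) {μ : Measure E}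
    (hμ : μ = volume.withDensity fun x => ENNReal.ofReal (Real.exp (-Φ x) / Z))
    {s : ℝ} (hs : 0 ≤ s) :
    Integrable (fun q : E × E => ‖q.1 - q.2‖ ^ (s + 2)) (μ.prod μ) ∧
    Integrable (fun q : E × E => ‖q.1 - q.2‖ ^ s) (μ.prod μ) ∧
    m * ∫ q, ‖q.1 - q.2‖ ^ (s + 2) ∂(μ.prod μ) ≤
      (2 * (finrank ℝ E + s) + b) * ∫ q, ‖q.1 - q.2‖ ^ s ∂(μ.prod μ) := by
  obtain ⟨K, hK⟩ := exists_add_norm_le_of_dissipative hΦ hm hb hdiss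
  have hint := integrable_one_add_norm_pow_mul_exp_neg hΦ.continuous hK
  obtain ⟨A, hA, hA'⟩ := exists_norm_le_mul_one_add_norm hgrow
  have hgm := hΦ.continuous_gradient.measurable
  have hdens : Measurable fun x => ENNReal.ofReal (Real.exp (-Φ x) / Z) := by
    have := hΦ.continuous.measurable
    fun_prop
  have hfin : ∀ᵐ x : E, ENNReal.ofReal (Real.exp (-Φ x) / Z) < ⊤ :=
    Filter.Eventually.of_forall fun _ => ENNReal.ofReal_lt_top
  have htr : ∀ x, (ENNReal.ofReal (Real.exp (-Φ x) / Z)).toReal = Real.exp (-Φ x) / Z :=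
    fun x => ENNReal.toReal_ofReal (by positivity)
  have hmom : ∀ n : ℕ, Integrable (fun x : E => (1 + ‖x‖) ^ n) μ := by
    intro n
    rw [hμ, integrable_withDensity_iff_integrable_smul' hdens hfin]
    refine ((hint n).div_const Z).congr (Filter.Eventually.of_forall fun x => ?_)
    simp only [htr, smul_eq_mul]
    ring
  have hval : ∀ h : E → ℝ, ∫ x, h x ∂μ = (∫ x, h x * Real.exp (-Φ x)) / Z := by
    intro h
    rw [hμ, integral_withDensity_eq_integral_toReal_smul hdens hfin, ← integral_div]
    congr 1
    funext x
    simp only [htr, smul_eq_mul]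
    ring
  have : IsFiniteMeasure μ := by
    have h0 := hmom 0
    simp only [pow_zero] at h0
    simpa using (integrable_const_iff (μ := μ) (c := (1 : ℝ))).1 h0
  have hprod : ∀ (n : ℕ) (C : ℝ) (h : E × E → ℝ), Measurable h →
      (∀ q, |h q| ≤ C * ((1 + ‖q.1‖) ^ n * (1 + ‖q.2‖) ^ n)) → Integrable h (μ.prod μ) :=
    fun n C h hh hle => (((hmom n).mul_prod (hmom n)).const_mul C).mono' hh.aestronglyMeasurable
      (Filter.Eventually.of_forall hle)
  have hpow : ∀ r : ℝ, 0 ≤ r → Integrable (fun q : E × E => ‖q.1 - q.2‖ ^ r) (μ.prod μ) := by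
    intro r hr
    obtain ⟨n, hn⟩ := exists_nat_ge r
    refine hprod n 1 _ (by fun_prop) fun q => ?_
    rw [one_mul, abs_of_nonneg (Real.rpow_nonneg (norm_nonneg _) _)]
    exact norm_sub_rpow_le_one_add_norm_pow hr hn _ _
  have hI := hpow s hs
  have hI2 := hpow (s + 2) (by linarith)
  refine ⟨hI2, hI, ?_⟩
  set F : E × E → ℝ := fun q => ‖q.1 - q.2‖ ^ s * ⟪q.1 - q.2, gradient Φ q.1⟫_ℝ with hF
  have hFint : Integrable F (μ.prod μ) := by
    obtain ⟨n, hn⟩ := exists_nat_ge (s + 1)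
    refine hprod (n + 1) A F (by fun_prop) fun q => ?_
    have h1 : 0 ≤ ‖q.1 - q.2‖ ^ s := Real.rpow_nonneg (norm_nonneg _) _
    rw [hF, abs_mul, abs_of_nonneg h1]
    have h2 : (1 + ‖q.2‖) ^ n ≤ (1 + ‖q.2‖) ^ (n + 1) :=
      pow_le_pow_right₀ (by linarith [norm_nonneg q.2]) n.le_succ
    calc _ ≤ ‖q.1 - q.2‖ ^ s * (‖q.1 - q.2‖ * (A * (1 + ‖q.1‖))) := by
          gcongr
          exact (abs_real_inner_le_norm _ _).trans (by gcongr; exact hA' _)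
      _ = ‖q.1 - q.2‖ ^ (s + 1) * (A * (1 + ‖q.1‖)) := by
          rw [Real.rpow_add_one' (norm_nonneg _) (by linarith)]
          ring
      _ ≤ ((1 + ‖q.1‖) ^ n * (1 + ‖q.2‖) ^ (n + 1)) * (A * (1 + ‖q.1‖)) := by
          gcongr
          refine (norm_sub_rpow_le_one_add_norm_pow (by linarith) hn _ _).trans ?_
          gcongr
      _ = _ := by ring
  have hFval : ∫ q, F q ∂(μ.prod μ) =
      (finrank ℝ E + s) * ∫ q, ‖q.1 - q.2‖ ^ s ∂(μ.prod μ) := by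
    rw [integral_prod_symm _ hFint, integral_prod_symm _ hI, ← integral_const_mul]
    congr 1
    funext y
    rw [← integral_const_mul, hval, hval,
      integral_norm_sub_rpow_mul_inner_gradient hΦ hint hA' hs y]
  have hle : ∀ q : E × E, m * ‖q.1 - q.2‖ ^ (s + 2) ≤
      F q + F q.swap + b * ‖q.1 - q.2‖ ^ s := by
    intro q
    have h1 : 0 ≤ ‖q.1 - q.2‖ ^ s := Real.rpow_nonneg (norm_nonneg _) _
    have h2 : ‖q.1 - q.2‖ ^ (s + 2) = ‖q.1 - q.2‖ ^ s * ‖q.1 - q.2‖ ^ 2 := by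
      rw [Real.rpow_add' (norm_nonneg _) (by linarith), Real.rpow_two]
    have h3 : F q + F q.swap =
        ‖q.1 - q.2‖ ^ s * ⟪q.1 - q.2, gradient Φ q.1 - gradient Φ q.2⟫_ℝ := by
      simp only [hF, Prod.fst_swap, Prod.snd_swap]
      rw [norm_sub_rev q.2 q.1, ← neg_sub q.1 q.2, inner_neg_left, inner_sub_right]
      ring
    rw [h2, h3]
    nlinarith [mul_le_mul_of_nonneg_left (hdiss q.1 q.2) h1]
  have hFs : Integrable (fun q => F q.swap) (μ.prod μ) := hFint.swap
  have hFF : Integrable (fun q => F q + F q.swap) (μ.prod μ) := hFint.add hFs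
  calc m * ∫ q, ‖q.1 - q.2‖ ^ (s + 2) ∂(μ.prod μ)
      = ∫ q, m * ‖q.1 - q.2‖ ^ (s + 2) ∂(μ.prod μ) := (integral_const_mul _ _).symm
    _ ≤ ∫ q, (F q + F q.swap + b * ‖q.1 - q.2‖ ^ s) ∂(μ.prod μ) :=
        integral_mono (hI2.const_mul m) (hFF.add (hI.const_mul b)) hle
    _ = _ := by
        rw [integral_add hFF (hI.const_mul b), integral_add hFint hFs,
          integral_const_mul, integral_prod_swap, hFval]
        ring

end GibbsMoments

theorem stmt_10 {d : ℕ} (Φ : EuclideanSpace ℝ (Fin d) → ℝ) (hΦ : ContDiff ℝ 1 Φ)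
    (m b G L : ℝ) (hm : 0 < m) (hb : 0 ≤ b)
    (hdiss : ∀ x y : EuclideanSpace ℝ (Fin d),
      ⟪x - y, gradient Φ x - gradient Φ y⟫_ℝ ≥ m * ‖x - y‖ ^ 2 - b)
    (hgrow : ∀ x : EuclideanSpace ℝ (Fin d), ‖gradient Φ x‖ ≤ G + L * ‖x‖)
    (μ : Measure (EuclideanSpace ℝ (Fin d)))
    (hμ : μ = volume.withDensity fun x =>
      ENNReal.ofReal (Real.exp (-Φ x) / ∫ y : EuclideanSpace ℝ (Fin d), Real.exp (-Φ y)))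
    (p : ℝ) (hp : 2 ≤ p) :
    Integrable (fun q : EuclideanSpace ℝ (Fin d) × EuclideanSpace ℝ (Fin d) =>
      ‖q.1 - q.2‖ ^ p) (μ.prod μ) ∧
    Integrable (fun q : EuclideanSpace ℝ (Fin d) × EuclideanSpace ℝ (Fin d) =>
      ‖q.1 - q.2‖ ^ (p - 2)) (μ.prod μ) ∧
    m * ∫ q, ‖q.1 - q.2‖ ^ p ∂(μ.prod μ) ≤
      (2 * ((d : ℝ) + p - 2) + b) * ∫ q, ‖q.1 - q.2‖ ^ (p - 2) ∂(μ.prod μ) := by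
  have h := integral_norm_sub_rpow_le_of_dissipative hΦ hm hb hdiss hgrow
    (integral_nonneg fun _ => (Real.exp_pos _).le) hμ (sub_nonneg.2 hp)
  rwa [sub_add_cancel, finrank_euclideanSpace_fin, ← add_sub_assoc] at h
end

section
/- Let V : ℝ^d → ℝ be twice continuously differentiable with ‖∇²V(x)‖_op ≤ L and two-point dissipativity ⟨x - y, ∇V(x) - ∇V(y)⟩ ≥ m‖x - y‖² - b for all x, y (m > 0, b ≥ 0), and suppose ‖∇V(x)‖ ≤ G + L‖x‖. Fix a > 0 and γ > 0 and define q(y) := ∫_{ℝ^d} exp(-V(x) - ‖y - a x‖²/(2γ²)) dx. Then for every y ∈ ℝ^d, ‖∇²_y log q(y)‖_op ≤ L(2d + b)/(2(a² + mγ²)). -/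
open MeasureTheory
open scoped InnerProductSpace

/-- A continuous function of exponential growth is integrable for a measure with all exponential
moments. -/
theorem integrable_of_norm_le_exp_norm {E F : Type*} [NormedAddCommGroup E] [MeasurableSpace E]
    [BorelSpace E] [SecondCountableTopology E] [NormedAddCommGroup F] {μ : Measure E}
    (hμ : ∀ K : ℝ, Integrable (fun x => Real.exp (K * ‖x‖)) μ) {f : E → F} (hf : Continuous f)
    {C K : ℝ} (hfb : ∀ x, ‖f x‖ ≤ C * Real.exp (K * ‖x‖)) : Integrable f μ :=
  ((hμ K).const_mul C).mono' hf.aestronglyMeasurable (.of_forall hfb)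

theorem norm_le_one_mul_exp_norm {E : Type*} [SeminormedAddCommGroup E] (x : E) :
    ‖x‖ ≤ 1 * Real.exp (1 * ‖x‖) := by
  rw [one_mul, one_mul]
  linarith [Real.add_one_le_exp ‖x‖]

theorem memLp_two_id_of_exp_moments {E : Type*} [NormedAddCommGroup E] [MeasurableSpace E]
    [BorelSpace E] [SecondCountableTopology E] {μ : Measure E}
    (hμ : ∀ K : ℝ, Integrable (fun x => Real.exp (K * ‖x‖)) μ) : MemLp (fun x : E => x) 2 μ := by
  refine (memLp_two_iff_integrable_sq_norm (f := fun x : E => x)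
    continuous_id.aestronglyMeasurable).2 ?_
  refine integrable_of_norm_le_exp_norm hμ (by fun_prop) (C := 1) (K := 2) fun x => ?_
  have h := norm_le_one_mul_exp_norm x
  simp only [one_mul] at h
  rw [norm_pow, norm_norm, one_mul, mul_comm, mul_two, Real.exp_add, sq]
  gcongr

theorem MeasureTheory.MemLp.integrable_real_inner {α E : Type*} [NormedAddCommGroup E]
    [InnerProductSpace ℝ E] [MeasurableSpace α] {ν : Measure α} {f g : α → E} (hf : MemLp f 2 ν)
    (hg : MemLp g 2 ν) :
    Integrable (fun x => ⟪f x, g x⟫_ℝ) ν :=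
  (hf.norm.integrable_mul hg.norm).mono' (hf.1.inner hg.1)
    (.of_forall fun _ => norm_inner_le_norm _ _)

section ExponentialFamily

variable {E F : Type*} [NormedAddCommGroup E] [InnerProductSpace ℝ E] [NormedAddCommGroup F]
  [NormedSpace ℝ F]

theorem norm_exp_inner_smul_le {f : E → F} {C K : ℝ}
    (hfb : ∀ x, ‖f x‖ ≤ C * Real.exp (K * ‖x‖)) (θ x : E) :
    ‖Real.exp ⟪θ, x⟫_ℝ • f x‖ ≤ C * Real.exp ((K + ‖θ‖) * ‖x‖) := by
  rw [norm_smul, Real.norm_eq_abs, Real.abs_exp]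
  calc Real.exp ⟪θ, x⟫_ℝ * ‖f x‖
      ≤ Real.exp (‖θ‖ * ‖x‖) * (C * Real.exp (K * ‖x‖)) := by
        gcongr
        · exact real_inner_le_norm _ _
        · exact hfb x
    _ = C * Real.exp ((K + ‖θ‖) * ‖x‖) := by
        rw [add_mul, Real.exp_add]; ring

theorem norm_innerSL_smulRight_exp_inner_smul_le {f : E → F} {C K : ℝ}
    (hfb : ∀ x, ‖f x‖ ≤ C * Real.exp (K * ‖x‖)) (θ x : E) :
    ‖(innerSL ℝ x).smulRight (Real.exp ⟪θ, x⟫_ℝ • f x)‖ ≤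
      C * Real.exp ((K + ‖θ‖ + 1) * ‖x‖) := by
  rw [ContinuousLinearMap.norm_smulRight_apply, innerSL_apply_norm]
  calc ‖x‖ * ‖Real.exp ⟪θ, x⟫_ℝ • f x‖
      ≤ Real.exp ‖x‖ * (C * Real.exp ((K + ‖θ‖) * ‖x‖)) := by
        gcongr
        · linarith [Real.add_one_le_exp ‖x‖]
        · exact norm_exp_inner_smul_le hfb θ x
    _ = C * Real.exp ((K + ‖θ‖ + 1) * ‖x‖) := by
        rw [mul_left_comm, ← Real.exp_add]; ring_nf

variable [MeasurableSpace E] {μ : Measure E}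

theorem integral_tilted_inner (θ : E) (f : E → F) :
    ∫ x, f x ∂(μ.tilted fun x => ⟪θ, x⟫_ℝ) =
      (∫ x, Real.exp ⟪θ, x⟫_ℝ ∂μ)⁻¹ • ∫ x, Real.exp ⟪θ, x⟫_ℝ • f x ∂μ := by
  rw [integral_tilted, ← integral_smul]
  congr with x
  rw [smul_smul, div_eq_inv_mul]

variable [BorelSpace E] [SecondCountableTopology E]

theorem integrable_exp_inner_smul (hμ : ∀ K : ℝ, Integrable (fun x => Real.exp (K * ‖x‖)) μ)
    {f : E → F} (hf : Continuous f) {C K : ℝ} (hfb : ∀ x, ‖f x‖ ≤ C * Real.exp (K * ‖x‖)) (θ : E) :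
    Integrable (fun x => Real.exp ⟪θ, x⟫_ℝ • f x) μ :=
  integrable_of_norm_le_exp_norm hμ (by fun_prop) (norm_exp_inner_smul_le hfb θ)

theorem integrable_innerSL_smulRight_exp_inner_smul
    (hμ : ∀ K : ℝ, Integrable (fun x => Real.exp (K * ‖x‖)) μ)
    {f : E → F} (hf : Continuous f) {C K : ℝ} (hfb : ∀ x, ‖f x‖ ≤ C * Real.exp (K * ‖x‖)) (θ : E) :
    Integrable (fun x => (innerSL ℝ x).smulRight (Real.exp ⟪θ, x⟫_ℝ • f x)) μ :=
  integrable_of_norm_le_exp_norm hμ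
    ((ContinuousLinearMap.smulRightL ℝ E F).continuous₂.comp
      (f := fun x => (innerSL ℝ x, Real.exp ⟪θ, x⟫_ℝ • f x)) (by fun_prop))
    (norm_innerSL_smulRight_exp_inner_smul_le hfb θ)

theorem hasFDerivAt_integral_exp_inner_smul
    (hμ : ∀ K : ℝ, Integrable (fun x => Real.exp (K * ‖x‖)) μ)
    {f : E → F} (hf : Continuous f) {C K : ℝ} (hfb : ∀ x, ‖f x‖ ≤ C * Real.exp (K * ‖x‖)) (θ : E) :
    HasFDerivAt (fun θ => ∫ x, Real.exp ⟪θ, x⟫_ℝ • f x ∂μ)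
      (∫ x, (innerSL ℝ x).smulRight (Real.exp ⟪θ, x⟫_ℝ • f x) ∂μ) θ := by
  have hC : 0 ≤ C := by
    have := (norm_nonneg _).trans (hfb 0)
    simpa using this
  refine hasFDerivAt_integral_of_dominated_of_fderiv_le (Metric.ball_mem_nhds θ one_pos)
    (F' := fun θ x => (innerSL ℝ x).smulRight (Real.exp ⟪θ, x⟫_ℝ • f x))
    (bound := fun x => C * Real.exp ((K + (‖θ‖ + 1) + 1) * ‖x‖))
    (.of_forall fun θ => (integrable_exp_inner_smul hμ hf hfb θ).1)
    (integrable_exp_inner_smul hμ hf hfb θ)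
    (integrable_innerSL_smulRight_exp_inner_smul hμ hf hfb θ).1 ?_ ((hμ _).const_mul C) ?_
  · refine .of_forall fun x η hη => (norm_innerSL_smulRight_exp_inner_smul_le hfb η x).trans ?_
    have hη' : ‖η‖ ≤ ‖θ‖ + 1 := by
      have := norm_le_norm_add_norm_sub' η θ
      rw [mem_ball_iff_norm] at hη
      linarith
    gcongr
  · refine .of_forall fun x η _ => ?_
    have h1 : HasFDerivAt (fun η : E => ⟪η, x⟫_ℝ) (innerSL ℝ x) η := by
      simpa [real_inner_comm] using (innerSL ℝ x).hasFDerivAt (x := η)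
    convert h1.exp.smul_const (f x) using 1
    ext v
    simp [smul_smul, mul_comm]

theorem integral_innerSL_smulRight_exp_inner_smul_apply
    (hμ : ∀ K : ℝ, Integrable (fun x => Real.exp (K * ‖x‖)) μ)
    {f : E → F} (hf : Continuous f) {C K : ℝ} (hfb : ∀ x, ‖f x‖ ≤ C * Real.exp (K * ‖x‖))
    (θ u : E) :
    (∫ x, (innerSL ℝ x).smulRight (Real.exp ⟪θ, x⟫_ℝ • f x) ∂μ) u =
      ∫ x, Real.exp ⟪θ, x⟫_ℝ • ⟪x, u⟫_ℝ • f x ∂μ := by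
  rw [ContinuousLinearMap.integral_apply
    (integrable_innerSL_smulRight_exp_inner_smul hμ hf hfb θ)]
  simp_rw [ContinuousLinearMap.smulRight_apply, innerSL_apply_apply, smul_comm ⟪_, u⟫_ℝ]

theorem integrable_exp_inner (hμ : ∀ K : ℝ, Integrable (fun x => Real.exp (K * ‖x‖)) μ) (θ : E) :
    Integrable (fun x => Real.exp ⟪θ, x⟫_ℝ) μ := by
  simpa using integrable_exp_inner_smul hμ (f := fun _ => (1 : ℝ)) (C := 1) (K := 0)
    continuous_const (by simp) θ

theorem integrable_exp_norm_tilted_inner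
    (hμ : ∀ K : ℝ, Integrable (fun x => Real.exp (K * ‖x‖)) μ) (θ : E) (K : ℝ) :
    Integrable (fun x => Real.exp (K * ‖x‖)) (μ.tilted fun x => ⟪θ, x⟫_ℝ) :=
  (integrable_tilted_iff (integrable_exp_inner hμ θ) _).2
    (integrable_exp_inner_smul hμ (C := 1) (K := K) (by fun_prop) (by simp) θ)

variable [CompleteSpace E]

theorem hasGradientAt_log_integral_exp_inner [NeZero μ]
    (hμ : ∀ K : ℝ, Integrable (fun x => Real.exp (K * ‖x‖)) μ) (θ : E) :
    HasGradientAt (fun θ => Real.log (∫ x, Real.exp ⟪θ, x⟫_ℝ ∂μ))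
      (∫ x, x ∂(μ.tilted fun x => ⟪θ, x⟫_ℝ)) θ := by
  have hZ : 0 < ∫ x, Real.exp ⟪θ, x⟫_ℝ ∂μ := integral_exp_pos (integrable_exp_inner hμ θ)
  have h := hasFDerivAt_integral_exp_inner_smul hμ (f := fun _ => (1 : ℝ)) (C := 1) (K := 0)
    continuous_const (by simp) θ
  have happ := integral_innerSL_smulRight_exp_inner_smul_apply hμ (f := fun _ => (1 : ℝ))
    (C := 1) (K := 0) continuous_const (by simp) θ
  simp only [smul_eq_mul, mul_one] at h happ
  rw [hasGradientAt_iff_hasFDerivAt]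
  refine (h.log hZ.ne').congr_fderiv ?_
  ext v
  have hx := integrable_exp_inner_smul hμ (f := fun x => x) continuous_id norm_le_one_mul_exp_norm θ
  rw [InnerProductSpace.toDual_apply_apply, integral_tilted_inner, real_inner_smul_left,
    real_inner_comm, ← integral_inner hx, smul_apply, happ, smul_eq_mul]
  simp_rw [real_inner_smul_right, real_inner_comm v]

theorem hasFDerivAt_integral_tilted_inner [NeZero μ]
    (hμ : ∀ K : ℝ, Integrable (fun x => Real.exp (K * ‖x‖)) μ) (θ : E) :
    ∃ S : E →L[ℝ] E, HasFDerivAt (fun θ => ∫ x, x ∂(μ.tilted fun x => ⟪θ, x⟫_ℝ)) S θ ∧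
      ∀ u v, ⟪S u, v⟫_ℝ =
        ∫ x, ⟪x - ∫ z, z ∂(μ.tilted fun x => ⟪θ, x⟫_ℝ), u⟫_ℝ *
          ⟪x - ∫ z, z ∂(μ.tilted fun x => ⟪θ, x⟫_ℝ), v⟫_ℝ ∂(μ.tilted fun x => ⟪θ, x⟫_ℝ) := by
  have hexp := integrable_exp_inner hμ θ
  have hZ : 0 < ∫ x, Real.exp ⟪θ, x⟫_ℝ ∂μ := integral_exp_pos hexp
  have h1 := hasFDerivAt_integral_exp_inner_smul hμ (f := fun _ => (1 : ℝ)) (C := 1) (K := 0)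
    continuous_const (by simp) θ
  have happ1 := integral_innerSL_smulRight_exp_inner_smul_apply hμ (f := fun _ => (1 : ℝ))
    (C := 1) (K := 0) continuous_const (by simp) θ
  simp only [smul_eq_mul, mul_one] at h1 happ1
  have h2 := hasFDerivAt_integral_exp_inner_smul hμ (f := fun x => x) continuous_id
    norm_le_one_mul_exp_norm θ
  have happ2 := integral_innerSL_smulRight_exp_inner_smul_apply hμ (f := fun x => x)
    continuous_id norm_le_one_mul_exp_norm θ
  have h3 := ((hasDerivAt_inv hZ.ne').comp_hasFDerivAt θ h1).smul h2
  have hM : (fun θ : E => ∫ x, x ∂(μ.tilted fun x => ⟪θ, x⟫_ℝ)) = fun θ : E =>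
    (∫ x, Real.exp ⟪θ, x⟫_ℝ ∂μ)⁻¹ • ∫ x, Real.exp ⟪θ, x⟫_ℝ • x ∂μ :=
    funext fun θ => integral_tilted_inner θ fun x => x
  refine ⟨_, by rw [hM]; exact h3, fun u v => ?_⟩
  have := isProbabilityMeasure_tilted hexp
  have hL := memLp_two_id_of_exp_moments (integrable_exp_norm_tilted_inner hμ θ)
  have hu := integral_tilted_inner (μ := μ) θ fun x => ⟪x, u⟫_ℝ
  have huv := integral_tilted_inner (μ := μ) θ fun x => ⟪x, u⟫_ℝ • x
  have hx := integral_tilted_inner (μ := μ) θ fun x => x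
  simp_rw [smul_eq_mul] at hu
  simp only [add_apply, smul_apply, happ2,
    ContinuousLinearMap.smulRight_apply, happ1, smul_eq_mul, Function.comp_apply]
  set P := μ.tilted fun x => ⟪θ, x⟫_ℝ
  set Z := ∫ x, Real.exp ⟪θ, x⟫_ℝ ∂μ
  have hi : Integrable (fun x : E => x) P := hL.integrable (by norm_num)
  have hi2 : Integrable (fun x : E => ⟪x, u⟫_ℝ • x) P :=
    memLp_one_iff_integrable.1 (hL.smul (hL.inner_const u))
  have hmean : ∀ w, ⟪∫ x, x ∂P, w⟫_ℝ = ∫ x, ⟪x, w⟫_ℝ ∂P := fun w => by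
    simp_rw [real_inner_comm w, integral_inner hi]
  have key : ∫ x, ⟪x - ∫ z, z ∂P, u⟫_ℝ * ⟪x - ∫ z, z ∂P, v⟫_ℝ ∂P =
      ⟪∫ x, ⟪x, u⟫_ℝ • x ∂P, v⟫_ℝ - (∫ x, ⟪x, u⟫_ℝ ∂P) * ⟪∫ z, z ∂P, v⟫_ℝ := by
    simp_rw [inner_sub_left, hmean, real_inner_comm v (∫ x, ⟪x, u⟫_ℝ • x ∂P), ← integral_inner hi2,
      real_inner_smul_right]
    simpa [real_inner_comm, ProbabilityTheory.covariance] using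
      ProbabilityTheory.covariance_eq_sub (hL.inner_const u) (hL.inner_const v)
  rw [key, huv, hu, hx]
  simp only [inner_add_left, real_inner_smul_left]
  field_simp
  ring

end ExponentialFamily

section IntegrationByParts

variable {E : Type*} [NormedAddCommGroup E] [InnerProductSpace ℝ E] [FiniteDimensional ℝ E]
  [MeasurableSpace E]
variable {P : Measure E} [IsProbabilityMeasure P] {W : E → E}

theorem integral_sub_const_inner (hi : Integrable (fun x => x) P) (c w : E) :
    ∫ x, ⟪x - c, w⟫_ℝ ∂P = ⟪∫ x, x ∂P - c, w⟫_ℝ := by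
  simp_rw [real_inner_comm w]
  rw [integral_inner (hi.sub' (integrable_const c)), integral_sub hi (integrable_const c)]
  simp

theorem integral_inner_sub_eq_finrank (hx : MemLp (fun x => x) 2 P) (hW : MemLp W 2 P)
    (hibp : ∀ c u v, ∫ x, ⟪x - c, u⟫_ℝ * ⟪W x, v⟫_ℝ ∂P = ⟪u, v⟫_ℝ) (c : E) :
    ∫ x, ⟪x - c, W x⟫_ℝ ∂P = Module.finrank ℝ E := by
  have hxc : MemLp (fun x => x - c) 2 P := hx.sub (memLp_const c)
  let e := stdOrthonormalBasis ℝ E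
  simp_rw [← e.sum_inner_mul_inner (_ - c) (W _)]
  rw [integral_finsetSum]
  · simp_rw [real_inner_comm (W _), hibp]
    simp
  · intro i _
    exact (hxc.inner_const _).integrable_mul (hW.const_inner _)

theorem integral_norm_sub_sq_eq_add (hx : MemLp (fun x => x) 2 P) (c : E) :
    ∫ x, ‖x - c‖ ^ 2 ∂P = ∫ x, ‖x - ∫ z, z ∂P‖ ^ 2 ∂P + ‖c - ∫ z, z ∂P‖ ^ 2 := by
  set M := ∫ z, z ∂P
  have hi : Integrable (fun x : E => x) P := hx.integrable (by norm_num)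
  have hxM : MemLp (fun x => x - M) 2 P := hx.sub (memLp_const M)
  have h0 : ∫ x, ⟪c - M, x - M⟫_ℝ ∂P = 0 := by
    simp_rw [real_inner_comm _ (c - M), integral_sub_const_inner hi, M, sub_self, inner_zero_left]
  have h : ∀ x : E, ‖x - c‖ ^ 2 = ‖x - M‖ ^ 2 - 2 * ⟪c - M, x - M⟫_ℝ + ‖c - M‖ ^ 2 := fun x => by
    rw [real_inner_comm, ← norm_sub_sq_real, sub_sub_sub_cancel_right]
  have hs : Integrable (fun x => ‖x - M‖ ^ 2) P := hxM.norm.integrable_sq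
  have hin : Integrable (fun x => 2 * ⟪c - M, x - M⟫_ℝ) P :=
    ((hxM.const_inner _).integrable (by norm_num)).const_mul 2
  simp_rw [h]
  rw [integral_add (hs.sub' hin) (integrable_const _), integral_sub hs hin, integral_const_mul, h0]
  simp

/-- Variance bound for a measure satisfying the integration by parts formula with a two-point
dissipative drift. -/
theorem integral_norm_sub_mean_sq_le (hx : MemLp (fun x => x) 2 P) (hW : MemLp W 2 P)
    (hibp : ∀ c u v, ∫ x, ⟪x - c, u⟫_ℝ * ⟪W x, v⟫_ℝ ∂P = ⟪u, v⟫_ℝ) {κ b : ℝ} (hκ : 0 < κ)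
    (hdiss : ∀ x y, κ * ‖x - y‖ ^ 2 - b ≤ ⟪x - y, W x - W y⟫_ℝ) :
    ∫ x, ‖x - ∫ z, z ∂P‖ ^ 2 ∂P ≤ (2 * Module.finrank ℝ E + b) / (2 * κ) := by
  have hvar := integral_norm_sub_sq_eq_add hx
  set M := ∫ z, z ∂P with hM
  have hi : Integrable (fun x : E => x) P := hx.integrable (by norm_num)
  have hc (c : E) : MemLp (fun x => x - c) 2 P := hx.sub (memLp_const c)
  have hs (c : E) : Integrable (fun x => ‖x - c‖ ^ 2) P := (hc c).norm.integrable_sq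
  have hcW (c : E) : Integrable (fun x => ⟪x - c, W x⟫_ℝ) P := (hc c).integrable_real_inner hW
  have htr := integral_inner_sub_eq_finrank hx hW hibp
  have h1 : ∀ y, κ * (∫ x, ‖x - M‖ ^ 2 ∂P + ‖y - M‖ ^ 2) - b ≤
      Module.finrank ℝ E + ⟪y - M, W y⟫_ℝ := fun y => by
    have hconst : Integrable (fun x => ⟪x - y, W y⟫_ℝ) P :=
      ((hc y).inner_const _).integrable (by norm_num)
    have := integral_mono (((hs y).const_mul κ).sub' (integrable_const b))
      ((hcW y).sub' hconst) fun x => by simpa [inner_sub_right] using hdiss x y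
    rw [integral_sub ((hs y).const_mul κ) (integrable_const b), integral_sub (hcW y) hconst,
      integral_const_mul, hvar, htr, integral_sub_const_inner hi, ← hM,
      ← neg_sub y M, inner_neg_left] at this
    simpa using this
  have h2 := integral_mono
    ((((integrable_const _).fun_add (hs M)).const_mul κ).sub' (integrable_const b))
    ((integrable_const _).fun_add (hcW M)) h1
  rw [integral_sub (((integrable_const _).fun_add (hs M)).const_mul κ) (integrable_const b),
    integral_const_mul, integral_add (integrable_const _) (hs M),
    integral_add (integrable_const _) (hcW M), htr] at h2
  simp only [integral_const, probReal_univ, one_smul] at h2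
  rw [le_div_iff₀ (by positivity)]
  linarith

/-- The right-hand side of the identity `s • Cov(X, X) - id = -Cov(X, B X)`, which integration by
parts gives for the drift `B x + s • x - θ`, is bounded by the variance when `B` is Lipschitz. -/
theorem abs_mul_covariance_sub_inner_le {B : E → E} {θ : E} {s L : ℝ}
    (hx : MemLp (fun x => x) 2 P) (hB : MemLp B 2 P)
    (hibp : ∀ c u v, ∫ x, ⟪x - c, u⟫_ℝ * ⟪B x + s • x - θ, v⟫_ℝ ∂P = ⟪u, v⟫_ℝ)
    (hL : ∀ x y, ‖B x - B y‖ ≤ L * ‖x - y‖) (u v : E) :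
    |s * ∫ x, ⟪x - ∫ z, z ∂P, u⟫_ℝ * ⟪x - ∫ z, z ∂P, v⟫_ℝ ∂P - ⟪u, v⟫_ℝ| ≤
      L * (∫ x, ‖x - ∫ z, z ∂P‖ ^ 2 ∂P) * (‖u‖ * ‖v‖) := by
  set M := ∫ z, z ∂P
  have hi : Integrable (fun x : E => x) P := hx.integrable (by norm_num)
  have hc : MemLp (fun x => x - M) 2 P := hx.sub (memLp_const M)
  have hBc : MemLp (fun x => B x - B M) 2 P := hB.sub (memLp_const _)
  have hs : Integrable (fun x => ‖x - M‖ ^ 2) P := hc.norm.integrable_sq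
  have h0 : ∫ x, ⟪x - M, u⟫_ℝ ∂P = 0 := by
    rw [integral_sub_const_inner hi, sub_self, inner_zero_left]
  have hcu : MemLp (fun x => ⟪x - M, u⟫_ℝ) 2 P := hc.inner_const u
  have hcc : Integrable (fun x => ⟪x - M, u⟫_ℝ * ⟪x - M, v⟫_ℝ) P :=
    hcu.integrable_mul (hc.inner_const v)
  have hcB : Integrable (fun x => ⟪x - M, u⟫_ℝ * ⟪B x - B M, v⟫_ℝ) P :=
    hcu.integrable_mul (hBc.inner_const v)
  have hck : Integrable (fun x => ⟪x - M, u⟫_ℝ * ⟪B M + s • M - θ, v⟫_ℝ) P :=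
    (hcu.integrable (by norm_num)).mul_const _
  have key : ⟪u, v⟫_ℝ = s * ∫ x, ⟪x - M, u⟫_ℝ * ⟪x - M, v⟫_ℝ ∂P +
      ∫ x, ⟪x - M, u⟫_ℝ * ⟪B x - B M, v⟫_ℝ ∂P := by
    have hsplit : ∀ x, ⟪x - M, u⟫_ℝ * ⟪B x + s • x - θ, v⟫_ℝ =
        s * (⟪x - M, u⟫_ℝ * ⟪x - M, v⟫_ℝ) + ⟪x - M, u⟫_ℝ * ⟪B x - B M, v⟫_ℝ +
          ⟪x - M, u⟫_ℝ * ⟪B M + s • M - θ, v⟫_ℝ := fun x => by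
      simp only [inner_add_left, inner_sub_left, real_inner_smul_left]
      ring
    rw [← hibp M u v, integral_congr_ae (.of_forall hsplit),
      integral_add ((hcc.const_mul s).fun_add hcB) hck, integral_add (hcc.const_mul s) hcB,
      integral_const_mul, integral_mul_const, h0, zero_mul, add_zero]
  rw [key, sub_add_cancel_left, abs_neg, mul_right_comm, ← integral_const_mul]
  refine (norm_integral_le_integral_norm _).trans
    (integral_mono hcB.norm (hs.const_mul _) fun x => ?_)
  rw [norm_mul]
  calc ‖⟪x - M, u⟫_ℝ‖ * ‖⟪B x - B M, v⟫_ℝ‖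
      ≤ (‖x - M‖ * ‖u‖) * ((L * ‖x - M‖) * ‖v‖) := by
        gcongr
        · exact norm_inner_le_norm _ _
        · exact (norm_inner_le_norm _ _).trans (by gcongr; exact hL x M)
    _ = L * (‖u‖ * ‖v‖) * ‖x - M‖ ^ 2 := by ring

variable [BorelSpace E]

/-- Integration by parts for the measure with density proportional to `exp (-U)`. -/
theorem integral_inner_mul_inner_gradient_tilted {U : E → ℝ} {W : E → E}
    (hU : ∀ x, HasGradientAt U (W x) x) (hexp : Integrable fun x => Real.exp (-U x))
    (hx : MemLp (fun x => x) 2 (volume.tilted fun x => -U x))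
    (hW : MemLp W 2 (volume.tilted fun x => -U x)) (c u v : E) :
    ∫ x, ⟪x - c, u⟫_ℝ * ⟪W x, v⟫_ℝ ∂(volume.tilted fun x => -U x) = ⟪u, v⟫_ℝ := by
  have := isProbabilityMeasure_tilted hexp
  have hZ : 0 < ∫ x, Real.exp (-U x) := integral_exp_pos hexp
  have hxc : MemLp (fun x => ⟪x - c, u⟫_ℝ) 2 (volume.tilted fun x => -U x) :=
    (hx.sub (memLp_const c)).inner_const u
  have hf : ∀ x, HasFDerivAt (fun x : E => ⟪x - c, u⟫_ℝ) (innerSL ℝ u) x := fun x => by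
    simpa [real_inner_comm, inner_sub_right] using
      ((innerSL ℝ u).hasFDerivAt (x := x)).sub_const ⟪u, c⟫_ℝ
  have hg : ∀ x, HasFDerivAt (fun x => Real.exp (-U x)) (Real.exp (-U x) • -innerSL ℝ (W x)) x :=
    fun x => ((hU x).hasFDerivAt.neg).exp
  have hfv : ∀ x, fderiv ℝ (fun x : E => ⟪x - c, u⟫_ℝ) x v = ⟪u, v⟫_ℝ := fun x => by
    rw [(hf x).fderiv, innerSL_apply_apply]
  have hgv : ∀ x, fderiv ℝ (fun x => Real.exp (-U x)) x v = -(Real.exp (-U x) * ⟪W x, v⟫_ℝ) :=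
    fun x => by simp [(hg x).fderiv]
  have h1 : Integrable fun x => Real.exp (-U x) * (⟪x - c, u⟫_ℝ * ⟪W x, v⟫_ℝ) :=
    (integrable_tilted_iff hexp _).1 (hxc.integrable_mul (hW.inner_const v))
  have h2 : Integrable fun x => Real.exp (-U x) * ⟪x - c, u⟫_ℝ :=
    (integrable_tilted_iff hexp _).1 (hxc.integrable (by norm_num))
  have key := integral_mul_fderiv_eq_neg_fderiv_mul_of_integrable (μ := volume)
    (f := fun x : E => ⟪x - c, u⟫_ℝ) (g := fun x => Real.exp (-U x)) (v := v)
    (by simp_rw [hfv]; exact hexp.const_mul _)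
    (by simp_rw [hgv]; exact h1.neg.congr (.of_forall fun x => by simp; ring))
    (by simpa only [mul_comm] using h2) (fun x _ => (hf x).differentiableAt)
    (fun x _ => (hg x).differentiableAt)
  simp_rw [hfv, hgv, integral_const_mul, mul_neg, integral_neg, neg_inj] at key
  rw [integral_tilted]
  simp_rw [smul_eq_mul, div_mul_eq_mul_div, integral_div]
  rw [div_eq_iff hZ.ne', ← key]
  congr with x
  ring

end IntegrationByParts

section Potential

variable {E : Type*} [NormedAddCommGroup E] [InnerProductSpace ℝ E] [FiniteDimensional ℝ E]

/-- A two-point dissipative potential is bounded below by a function of linear growth. -/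
theorem exists_neg_le_add_mul_norm {V : E → ℝ} (hV : Differentiable ℝ V) {m b : ℝ} (hm : 0 ≤ m)
    (hb : 0 ≤ b) (hdiss : ∀ x y : E,
      ⟪x - y, gradient V x - gradient V y⟫_ℝ ≥ m * ‖x - y‖ ^ 2 - b) :
    ∃ C K : ℝ, ∀ x, -V x ≤ C + K * ‖x‖ := by
  obtain ⟨C, hC⟩ := (isCompact_closedBall (0 : E) 1).exists_bound_of_continuousOn
    hV.continuous.continuousOn
  refine ⟨C, b + ‖gradient V 0‖, fun x => ?_⟩
  rcases le_total ‖x‖ 1 with hx | hx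
  · have h1 := hC x (by simpa using hx)
    have h2 : 0 ≤ (b + ‖gradient V 0‖) * ‖x‖ := by positivity
    linarith [neg_le_abs (V x), Real.norm_eq_abs (V x)]
  · have hx0 : 0 < ‖x‖ := by linarith
    set u : E := ‖x‖⁻¹ • x with hu
    have hun : ‖u‖ = 1 := by rw [hu, norm_smul, norm_inv, norm_norm, inv_mul_cancel₀ hx0.ne']
    have hxu : x = ‖x‖ • u := by rw [hu, smul_smul, mul_inv_cancel₀ hx0.ne', one_smul]
    obtain ⟨z, hz, hmv⟩ := domain_mvt (f := V) (s := Set.univ) (x := u) (y := x)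
      (fun w _ => (hV w).hasFDerivAt.hasFDerivWithinAt) convex_univ trivial trivial
    obtain ⟨p, t, hp, ht, hpt, rfl⟩ := hz
    set c : ℝ := p + t * ‖x‖ with hc
    have hc1 : 1 ≤ c := by nlinarith
    have hz : p • u + t • x = c • u := by
      rw [hc, add_smul, mul_smul, ← hxu]
    have hsub : x - u = (‖x‖ - 1) • u := by
      rw [sub_smul, one_smul, ← hxu]
    rw [hz, hsub, map_smul, smul_eq_mul, ← inner_gradient_left] at hmv
    have h1 := hdiss (c • u) 0
    rw [sub_zero, real_inner_smul_left, inner_sub_right, real_inner_comm] at h1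
    have h2 : -‖gradient V 0‖ ≤ ⟪u, gradient V 0⟫_ℝ := by
      have := abs_real_inner_le_norm u (gradient V 0)
      rw [hun, one_mul] at this
      exact (abs_le.1 this).1
    have h3 : -(b + ‖gradient V 0‖) ≤ ⟪gradient V (c • u), u⟫_ℝ := by
      have : 0 ≤ m * ‖c • u‖ ^ 2 := by positivity
      by_contra! h
      nlinarith
    have h4 := hC u (by simp [hun])
    rw [Real.norm_eq_abs] at h4
    have h5 := neg_le_of_abs_le h4
    have h6 : 0 ≤ b + ‖gradient V 0‖ := by positivity
    nlinarith

end Potential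

section Gaussian

variable {E : Type*} [NormedAddCommGroup E] [InnerProductSpace ℝ E] [FiniteDimensional ℝ E]
  [MeasurableSpace E] [BorelSpace E]

theorem integrable_exp_mul_norm_sub_mul_norm_sq {c : ℝ} (hc : 0 < c) (K : ℝ) :
    Integrable fun x : E => Real.exp (K * ‖x‖ - c * ‖x‖ ^ 2) := by
  have h : Integrable fun x : E => Real.exp (-(c / 2) * ‖x‖ ^ 2) := by
    have := (GaussianFourier.integrable_cexp_neg_mul_sq_norm_add (V := E) (b := (c / 2 : ℝ))
      (by simpa using hc) 0 0).norm
    refine this.congr (.of_forall fun x => ?_)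
    simp only [Complex.norm_exp]
    norm_cast
    simp
  refine (h.const_mul (Real.exp (K ^ 2 / (2 * c)))).mono'
    (Continuous.aestronglyMeasurable (by fun_prop)) (.of_forall fun x => ?_)
  rw [Real.norm_eq_abs, Real.abs_exp, ← Real.exp_add]
  gcongr
  have : 0 ≤ (K - c * ‖x‖) ^ 2 / (2 * c) := by positivity
  have h2 : (K - c * ‖x‖) ^ 2 / (2 * c) = K ^ 2 / (2 * c) - K * ‖x‖ + c / 2 * ‖x‖ ^ 2 := by
    field_simp; ring
  linarith

theorem integrable_exp_neg_sub_mul_norm_sq_mul_exp {V : E → ℝ} (hV : Continuous V) {C K₀ : ℝ}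
    (hVb : ∀ x, -V x ≤ C + K₀ * ‖x‖) {c : ℝ} (hc : 0 < c) (K : ℝ) :
    Integrable fun x : E => Real.exp (-V x - c * ‖x‖ ^ 2) * Real.exp (K * ‖x‖) := by
  refine ((integrable_exp_mul_norm_sub_mul_norm_sq (E := E) hc (K₀ + K)).const_mul
    (Real.exp C)).mono' (Continuous.aestronglyMeasurable (by fun_prop)) (.of_forall fun x => ?_)
  rw [← Real.exp_add, ← Real.exp_add, Real.norm_eq_abs, Real.abs_exp, Real.exp_le_exp]
  linarith [hVb x, add_mul K₀ K ‖x‖]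

end Gaussian

theorem stmt_15 {d : ℕ} (V : EuclideanSpace ℝ (Fin d) → ℝ) (hV : ContDiff ℝ 2 V)
    (m b G L : ℝ) (hm : 0 < m) (hb : 0 ≤ b)
    (hhess : ∀ x : EuclideanSpace ℝ (Fin d), ‖fderiv ℝ (fun z => gradient V z) x‖ ≤ L)
    (hdiss : ∀ x y : EuclideanSpace ℝ (Fin d),
      ⟪x - y, gradient V x - gradient V y⟫_ℝ ≥ m * ‖x - y‖ ^ 2 - b)
    (hgrow : ∀ x : EuclideanSpace ℝ (Fin d), ‖gradient V x‖ ≤ G + L * ‖x‖)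
    (a γ : ℝ) (ha : 0 < a) (hγ : 0 < γ)
    (q : EuclideanSpace ℝ (Fin d) → ℝ)
    (hq : ∀ y, q y = ∫ x, Real.exp (-V x - ‖y - a • x‖ ^ 2 / (2 * γ ^ 2))) :
    ∀ y : EuclideanSpace ℝ (Fin d),
      ‖fderiv ℝ (fun z => gradient (fun w => Real.log (q w)) z) y‖ ≤
        L * (2 * (d : ℝ) + b) / (2 * (a ^ 2 + m * γ ^ 2)) := by
  have hVd : Differentiable ℝ V := hV.differentiable (by norm_num)
  have hVg : Differentiable ℝ (gradient V) := by
    have h1 : Differentiable ℝ (fderiv ℝ V) :=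
      (hV.fderiv_right (m := 1) (by norm_num)).differentiable (by norm_num)
    exact (InnerProductSpace.toDual ℝ _).symm.toContinuousLinearEquiv.differentiable.comp h1
  have hL0 : 0 ≤ L := (norm_nonneg _).trans (hhess 0)
  have hLip : ∀ x y, ‖gradient V x - gradient V y‖ ≤ L * ‖x - y‖ := fun x y =>
    (lipschitzWith_of_nnnorm_fderiv_le (C := ⟨L, hL0⟩) hVg hhess).norm_sub_le x y
  obtain ⟨C, K₀, hVb⟩ := exists_neg_le_add_mul_norm hVd hm.le hb hdiss
  set s : ℝ := a ^ 2 / γ ^ 2 with hs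
  have hs0 : 0 < s := by positivity
  set f : EuclideanSpace ℝ (Fin d) → ℝ := fun x => -V x - s / 2 * ‖x‖ ^ 2 with hf
  have hfK := integrable_exp_neg_sub_mul_norm_sq_mul_exp hVd.continuous hVb (half_pos hs0)
  have hfi : Integrable fun x => Real.exp (f x) := by simpa using hfK 0
  have := isProbabilityMeasure_tilted hfi
  set μ := volume.tilted f with hμ_def
  have hμ : ∀ K : ℝ, Integrable (fun x => Real.exp (K * ‖x‖)) μ := fun K =>
    (integrable_tilted_iff hfi _).2 (hfK K)
  set r : ℝ := a / γ ^ 2 with hr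
  have hlog : (fun w => Real.log (q w)) = fun w => -(1 / (2 * γ ^ 2)) * ‖w‖ ^ 2 +
      Real.log (∫ x, Real.exp (f x)) + Real.log (∫ x, Real.exp ⟪r • w, x⟫_ℝ ∂μ) := by
    funext w
    have hexp := integrable_exp_inner hμ (r • w)
    have hw : q w = Real.exp (-(1 / (2 * γ ^ 2)) * ‖w‖ ^ 2) * ((∫ x, Real.exp (f x)) *
        ∫ x, Real.exp ⟪r • w, x⟫_ℝ ∂μ) := by
      rw [integral_exp_tilted, mul_div_cancel₀ _ (integral_exp_pos hfi).ne', hq,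
        ← integral_const_mul]
      congr with x
      rw [← Real.exp_add, norm_sub_sq_real, real_inner_smul_right, norm_smul, Pi.add_apply,
        real_inner_smul_left, Real.norm_eq_abs, mul_pow, sq_abs, hf, hs, hr]
      congr 1
      field_simp
      ring
    rw [hw, Real.log_mul (by positivity) (mul_pos (integral_exp_pos hfi)
      (integral_exp_pos hexp)).ne', Real.log_mul (integral_exp_pos hfi).ne'
      (integral_exp_pos hexp).ne', Real.log_exp, add_assoc]
  have hgrad : (fun z => gradient (fun w => Real.log (q w)) z) = fun z =>
      r • (∫ x, x ∂(μ.tilted fun x => ⟪r • z, x⟫_ℝ)) - (1 / γ ^ 2) • z := by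
    funext z
    refine HasGradientAt.gradient ?_
    rw [hlog, hasGradientAt_iff_hasFDerivAt]
    have h1 := ((hasStrictFDerivAt_norm_sq z).hasFDerivAt.const_mul
      (-(1 / (2 * γ ^ 2)))).add_const (Real.log (∫ x, Real.exp (f x)))
    have h2 := (hasGradientAt_log_integral_exp_inner hμ (r • z)).hasFDerivAt.comp z
      ((hasFDerivAt_id z).const_smul r)
    refine (h1.add h2).congr_fderiv ?_
    ext v
    simp [real_inner_smul_left]
    ring
  intro y
  obtain ⟨S, hS, hSin⟩ := hasFDerivAt_integral_tilted_inner hμ (r • y)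
  have hH : HasFDerivAt (fun z => r • (∫ x, x ∂(μ.tilted fun x => ⟪r • z, x⟫_ℝ)) - (1 / γ ^ 2) • z)
      (r • S ∘L (r • ContinuousLinearMap.id ℝ _) - (1 / γ ^ 2) • ContinuousLinearMap.id ℝ _) y :=
    ((hS.comp y ((hasFDerivAt_id y).const_smul r)).const_smul r).sub
    ((hasFDerivAt_id y).const_smul (1 / γ ^ 2))
  rw [hgrad, hH.fderiv]
  have := isProbabilityMeasure_tilted (integrable_exp_inner hμ (r • y))
  have hx := memLp_two_id_of_exp_moments (integrable_exp_norm_tilted_inner hμ (r • y))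
  set U : EuclideanSpace ℝ (Fin d) → ℝ := fun x => -(f x + ⟪r • y, x⟫_ℝ) with hU
  have hP : (μ.tilted fun x => ⟪r • y, x⟫_ℝ) = volume.tilted fun x => -U x := by
    rw [hμ_def, tilted_tilted hfi]
    simp [hU, Pi.add_def]
  set P := μ.tilted fun x => ⟪r • y, x⟫_ℝ
  have hB : MemLp (gradient V) 2 P := by
    have h1 : MemLp (fun x => gradient V x - gradient V 0) 2 P :=
      hx.of_le_mul (c := L) (hVg.continuous.sub continuous_const).aestronglyMeasurable
        (.of_forall fun x => by simpa using hLip x 0)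
    convert h1.add (memLp_const (gradient V 0)) using 1
    funext x
    simp
  have hW : MemLp (fun x => gradient V x + s • x - r • y) 2 P :=
    (hB.add (hx.const_smul s)).sub (memLp_const _)
  have hUW : ∀ x, HasGradientAt U (gradient V x + s • x - r • y) x := fun x => by
    rw [hasGradientAt_iff_hasFDerivAt]
    have h1 := (((hVd x).hasGradientAt.hasFDerivAt.neg.sub
      ((hasStrictFDerivAt_norm_sq x).hasFDerivAt.const_mul (s / 2))).add
        (innerSL ℝ (r • y)).hasFDerivAt).neg
    refine h1.congr_fderiv ?_
    ext v
    simp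
    ring
  have hUi : Integrable fun x => Real.exp (-U x) := by
    have := (integrable_tilted_iff hfi _).1 (integrable_exp_inner hμ (r • y))
    simpa [hU, Real.exp_add] using this
  have hibp : ∀ c u v, ∫ x, ⟪x - c, u⟫_ℝ * ⟪gradient V x + s • x - r • y, v⟫_ℝ ∂P = ⟪u, v⟫_ℝ := by
    rw [hP] at hx hW ⊢
    exact integral_inner_mul_inner_gradient_tilted hUW hUi hx hW
  have hvar := integral_norm_sub_mean_sq_le hx hW hibp (κ := m + s) (b := b) (by positivity)
    fun x z => by
      have h1 := hdiss x z
      have h2 : gradient V x + s • x - r • y - (gradient V z + s • z - r • y) =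
        (gradient V x - gradient V z) + s • (x - z) := by rw [smul_sub]; abel
      rw [h2, inner_add_right, real_inner_smul_right, real_inner_self_eq_norm_sq]
      linarith
  have hcov := abs_mul_covariance_sub_inner_le hx hB hibp hLip
  rw [finrank_euclideanSpace_fin] at hvar
  refine ContinuousLinearMap.opNorm_le_of_re_inner_le (𝕜 := ℝ) (by positivity) fun u v hu hv => ?_
  have h3 := (le_abs_self _).trans (hcov u v)
  rw [hu, hv, ← hSin] at h3
  have h4 : ⟪(r • S ∘L (r • ContinuousLinearMap.id ℝ (EuclideanSpace ℝ (Fin d))) -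
      (1 / γ ^ 2) • ContinuousLinearMap.id ℝ (EuclideanSpace ℝ (Fin d))) u, v⟫_ℝ =
      (s * ⟪S u, v⟫_ℝ - ⟪u, v⟫_ℝ) / γ ^ 2 := by
    simp [inner_sub_left, real_inner_smul_left, hr, hs]
    field_simp
  refine h4.le.trans ?_
  calc (s * ⟪S u, v⟫_ℝ - ⟪u, v⟫_ℝ) / γ ^ 2
      ≤ (L * ((2 * d + b) / (2 * (m + s)))) / γ ^ 2 := by
        gcongr
        refine h3.trans ?_
        rw [mul_one, mul_one]
        gcongr
    _ = L * (2 * (d : ℝ) + b) / (2 * (a ^ 2 + m * γ ^ 2)) := by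
        rw [hs]; field_simp; ring
end
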